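/- arXiv:2306.07574 — 4 statements merged into one kernel-verified Lean document; each statement's English description precedes it below -/
import Mathlib

section
/- Let n ≥ 1 and let c ∈ ℝ^n be such that at least one of the following fails: (i) c_i ≤ 1 for all i, (ii) ∑_{i=1}^n c_i ≥ 1, (iii) c_i ∈ ℤ for all i. Then the hyperplane h = {x ∈ ℝ^n : ∑_{i=1}^n c_i x_i = 1} has weight w(h) ≤ 1 − 1/n. -/
open scoped Classical in
/-- The Clifton–Huang weight of the hyperplane `{x : ∑ i, c i * x i = 1}`:
the sum over nonempty subsets `S ⊆ [n]` with `∑_{i ∈ S} c i = 1` of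
`1 / (|S| * binom(n, |S|))`. -/
noncomputable def hyperplaneWeight {n : ℕ} (c : Fin n → ℝ) : ℝ :=
  ∑ S : Finset (Fin n),
    if S.Nonempty ∧ ∑ i ∈ S, c i = 1 then
      1 / (S.card * (n.choose S.card)) else 0

open Finset

/-- The walk `Q` first reaches a height at least `1` at time `t`, and its height is then `1`. -/
def FirstHits (Q : ℕ → ℝ) (t : ℕ) : Prop :=
  Q t = 1 ∧ ∀ s < t, Q s < 1

/-- The walk `Q` is at height `1` at time `t` and is never positive before. -/
def HitsFromNonpos (Q : ℕ → ℝ) (t : ℕ) : Prop :=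
  Q t = 1 ∧ ∀ s < t, Q s ≤ 0

lemma HitsFromNonpos.firstHits {Q : ℕ → ℝ} {t : ℕ} (h : HitsFromNonpos Q t) : FirstHits Q t :=
  ⟨h.1, fun s hs => (h.2 s hs).trans_lt one_pos⟩

lemma FirstHits.unique {Q : ℕ → ℝ} {t u : ℕ} (ht : FirstHits Q t) (hu : FirstHits Q u) :
    t = u := by
  rcases lt_trichotomy t u with h | h | h
  · exact absurd ht.1 (hu.2 t h).ne
  · exact h
  · exact absurd hu.1 (ht.2 u h).ne

open scoped Classical in
/-- The credit of the walk `Q` at time `t`: one half if it first hits `1` at time `t`, and another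
half if it does so without having been positive before. -/
noncomputable def hitValue (Q : ℕ → ℝ) (t : ℕ) : ℝ :=
  (if FirstHits Q t then 1 / 2 else 0) + (if HitsFromNonpos Q t then 1 / 2 else 0)

lemma hitValue_nonneg (Q : ℕ → ℝ) (t : ℕ) : 0 ≤ hitValue Q t := by
  unfold hitValue
  split_ifs <;> norm_num

lemma hitValue_congr {Q Q' : ℕ → ℝ} {t : ℕ} (h : ∀ s ≤ t, Q s = Q' s) :
    hitValue Q t = hitValue Q' t := by
  have h1 : FirstHits Q t ↔ FirstHits Q' t := by
    unfold FirstHits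
    rw [h t le_rfl]
    exact and_congr_right fun _ => forall₂_congr fun s hs => by rw [h s hs.le]
  have h2 : HitsFromNonpos Q t ↔ HitsFromNonpos Q' t := by
    unfold HitsFromNonpos
    rw [h t le_rfl]
    exact and_congr_right fun _ => forall₂_congr fun s hs => by rw [h s hs.le]
  classical
  exact congrArg₂ (· + ·) (if_congr h1 rfl rfl) (if_congr h2 rfl rfl)

lemma one_half_le_hitValue {Q : ℕ → ℝ} {t : ℕ} (h : FirstHits Q t) : 1 / 2 ≤ hitValue Q t := by
  unfold hitValue
  rw [if_pos h]
  split_ifs <;> norm_num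

lemma hitValue_eq_one {Q : ℕ → ℝ} {t : ℕ} (h : HitsFromNonpos Q t) : hitValue Q t = 1 := by
  unfold hitValue
  rw [if_pos h, if_pos h.firstHits]
  norm_num

lemma hitValue_eq_zero {Q : ℕ → ℝ} {t : ℕ} (h : ¬ FirstHits Q t) : hitValue Q t = 0 := by
  unfold hitValue
  rw [if_neg h, if_neg fun h' => h h'.firstHits, add_zero]

/-- The total credit of a walk over the times `1, …, N`. -/
noncomputable def totalValue (N : ℕ) (Q : ℕ → ℝ) : ℝ :=
  ∑ t ∈ Icc 1 N, hitValue Q t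

lemma totalValue_eq_hitValue {N t : ℕ} {Q : ℕ → ℝ} (htN : t ∈ Icc 1 N) (ht : FirstHits Q t) :
    totalValue N Q = hitValue Q t :=
  sum_eq_single_of_mem t htN fun _ _ hu => hitValue_eq_zero fun h => hu (h.unique ht)

lemma totalValue_eq_zero {N : ℕ} {Q : ℕ → ℝ} (h : ∀ t ∈ Icc 1 N, ¬ FirstHits Q t) :
    totalValue N Q = 0 :=
  sum_eq_zero fun t ht => hitValue_eq_zero (h t ht)

lemma totalValue_le_one (N : ℕ) (Q : ℕ → ℝ) : totalValue N Q ≤ 1 := by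
  by_cases h : ∃ t ∈ Icc 1 N, FirstHits Q t
  · obtain ⟨t, htN, ht⟩ := h
    rw [totalValue_eq_hitValue htN ht]
    unfold hitValue
    split_ifs <;> norm_num
  · push Not at h
    rw [totalValue_eq_zero h]
    exact zero_le_one

lemma totalValue_le_half {N : ℕ} {Q : ℕ → ℝ} (h : ∀ t ∈ Icc 1 N, ¬ HitsFromNonpos Q t) :
    totalValue N Q ≤ 1 / 2 := by
  by_cases h' : ∃ t ∈ Icc 1 N, FirstHits Q t
  · obtain ⟨t, htN, ht⟩ := h'
    rw [totalValue_eq_hitValue htN ht]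
    unfold hitValue
    rw [if_pos ht, if_neg (h t htN), add_zero]
  · push Not at h'
    rw [totalValue_eq_zero h']
    norm_num

lemma exists_first_argmax (f : ℕ → ℝ) {m : ℕ} (hm : 0 < m) :
    ∃ r < m, (∀ k < m, f k ≤ f r) ∧ ∀ k < r, f k < f r := by
  classical
  have hex : ∃ r, r < m ∧ ∀ k < m, f k ≤ f r := by
    obtain ⟨r, hr, h⟩ := exists_max_image (range m) f ⟨0, mem_range.2 hm⟩
    exact ⟨r, mem_range.1 hr, fun k hk => h k (mem_range.2 hk)⟩
  obtain ⟨hr, hmax⟩ := Nat.find_spec hex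
  refine ⟨Nat.find hex, hr, hmax, fun k hk => lt_of_not_ge fun hle => ?_⟩
  exact Nat.find_min hex hk ⟨hk.trans hr, fun j hj => (hmax j hj).trans hle⟩

/-- A form of the cycle lemma: the cyclic shifts of a closed-up walk of length `t` and total `1`
have total credit at least `1`. -/
lemma one_le_sum_hitValue {P : ℕ → ℝ} {t : ℕ} (ht : 0 < t) (hP : ∀ k, P (k + t) = P k + 1) :
    1 ≤ ∑ r ∈ range t, hitValue (fun s => P (r + s) - P r) t := by
  obtain ⟨r, hrt, hmax, hfirst⟩ := exists_first_argmax P ht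
  have hwrap : ∀ x, t ≤ x → P x = P (x - t) + 1 := fun x hx => by
    rw [← hP, Nat.sub_add_cancel hx]
  have hr : FirstHits (fun s => P (r + s) - P r) t := by
    refine ⟨by simp [hP], fun s hs => ?_⟩
    dsimp only
    rcases lt_or_ge (r + s) t with h | h
    · linarith [hmax _ h]
    · linarith [hwrap _ h, hfirst (r + s - t) (by omega)]
  by_cases hq : ∃ q < r, P r - 1 < P q
  · obtain ⟨q₀, hq₀r, hq₀⟩ := hq
    obtain ⟨q, hqr, hqmax, hqfirst⟩ := exists_first_argmax P (by omega : 0 < r)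
    have hq₁ := hqmax q₀ hq₀r
    have hq : FirstHits (fun s => P (q + s) - P q) t := by
      refine ⟨by simp [hP], fun s hs => ?_⟩
      dsimp only
      rcases lt_or_ge (q + s) t with h | h
      · linarith [hmax _ h]
      · linarith [hwrap _ h, hqfirst (q + s - t) (by omega)]
    have hsub : ({q, r} : Finset ℕ) ⊆ range t := by
      intro x
      simp only [mem_insert, mem_singleton, mem_range]
      omega
    calc (1 : ℝ) = 1 / 2 + 1 / 2 := by norm_num
      _ ≤ _ := add_le_add (one_half_le_hitValue hq) (one_half_le_hitValue hr)
      _ = ∑ x ∈ {q, r}, hitValue (fun s => P (x + s) - P x) t :=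
        (sum_pair (f := fun x => hitValue (fun s => P (x + s) - P x) t) hqr.ne).symm
      _ ≤ _ := sum_le_sum_of_subset_of_nonneg hsub fun _ _ _ => hitValue_nonneg _ _
  · push Not at hq
    have hr' : HitsFromNonpos (fun s => P (r + s) - P r) t := by
      refine ⟨hr.1, fun s hs => ?_⟩
      dsimp only
      rcases lt_or_ge (r + s) t with h | h
      · linarith [hmax _ h]
      · linarith [hwrap _ h, hq (r + s - t) (by omega)]
    rw [← hitValue_eq_one hr']
    exact single_le_sum (f := fun r => hitValue (fun s => P (r + s) - P r) t)
      (fun _ _ => hitValue_nonneg _ _) (mem_range.2 hrt)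

section Loss

variable {f : ℕ → ℝ} {N : ℕ}

lemma sum_range_le_sub_one_of_eq_zero (hf : ∀ r, f r ≤ 1) {r : ℕ} (hr : r < N) (h : f r = 0) :
    ∑ r ∈ range N, f r ≤ N - 1 := by
  rw [← add_sum_erase _ _ (mem_range.2 hr), h, zero_add]
  refine (sum_le_card_nsmul _ _ 1 fun x _ => hf x).trans ?_
  rw [card_erase_of_mem (mem_range.2 hr), card_range, nsmul_eq_mul, mul_one,
    Nat.cast_sub (by omega), Nat.cast_one]

lemma sum_range_le_sub_one_of_le_half (hf : ∀ r, f r ≤ 1) {r r' : ℕ} (hr : r < N) (hr' : r' < N)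
    (hne : r' ≠ r) (h : f r ≤ 1 / 2) (h' : f r' ≤ 1 / 2) :
    ∑ r ∈ range N, f r ≤ N - 1 := by
  have hmem : r' ∈ (range N).erase r := mem_erase.2 ⟨hne, mem_range.2 hr'⟩
  rw [← add_sum_erase _ _ (mem_range.2 hr), ← add_sum_erase _ _ hmem]
  have := sum_le_card_nsmul (((range N).erase r).erase r') f 1 fun x _ => hf x
  rw [card_erase_of_mem hmem, card_erase_of_mem (mem_range.2 hr), card_range, nsmul_eq_mul,
    mul_one, Nat.cast_sub (by omega), Nat.cast_sub (by omega), Nat.cast_one] at this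
  linarith

end Loss

/-- If a step exceeds `1`, or the total is less than `1`, or a step is not an integer, then the
cyclic shifts of a walk of length `N` have total credit at most `N - 1`. -/
lemma sum_totalValue_le {P : ℕ → ℝ} {N : ℕ} {T : ℝ} (hN : 0 < N) (hP : ∀ k, P (k + N) = P k + T)
    (h : (∃ r < N, 1 < P (r + 1) - P r) ∨ T < 1 ∨
      ∃ r < N, ∀ m : ℤ, (m : ℝ) ≠ P (r + 1) - P r) :
    ∑ r ∈ range N, totalValue N (fun s => P (r + s) - P r) ≤ N - 1 := by
  have hle : ∀ r, totalValue N (fun s => P (r + s) - P r) ≤ 1 := fun r => totalValue_le_one _ _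
  rcases h with ⟨r, hr, h⟩ | hT | ⟨r, hr, h⟩
  · refine sum_range_le_sub_one_of_eq_zero hle hr (totalValue_eq_zero fun t ht hhit => ?_)
    rcases (mem_Icc.1 ht).1.eq_or_lt with rfl | ht1
    · exact h.ne' hhit.1
    · exact (hhit.2 1 ht1).not_gt h
  · obtain ⟨r, hr, hmax, -⟩ := exists_first_argmax P hN
    refine sum_range_le_sub_one_of_eq_zero hle hr (totalValue_eq_zero fun t ht hhit => ?_)
    have h1 := hhit.1
    have htN := (mem_Icc.1 ht).2
    dsimp only at h1
    rcases lt_or_ge (r + t) N with h | h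
    · linarith [hmax _ h]
    · have h2 := hP (r + t - N)
      rw [Nat.sub_add_cancel h] at h2
      linarith [hmax (r + t - N) (by omega)]
  · by_cases hmiss : ∀ t ∈ Icc 1 N, ¬ FirstHits (fun s => P (r + s) - P r) t
    · exact sum_range_le_sub_one_of_eq_zero hle hr (totalValue_eq_zero hmiss)
    push Not at hmiss
    obtain ⟨t, htN, hhit⟩ := hmiss
    obtain ⟨ht1, htN⟩ := mem_Icc.1 htN
    have hend : P (r + t) - P r = 1 := hhit.1
    have hbefore : ∀ s < t, P (r + s) - P r < 1 := hhit.2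
    classical
    -- the last time before `t` at which the shifted walk is not an integer
    obtain ⟨m, hm, hmlast⟩ := exists_max_image
      ((range t).filter fun s => ∀ z : ℤ, (z : ℝ) ≠ P (r + s) - P r) id
      ⟨1, mem_filter.2 ⟨mem_range.2 (lt_of_le_of_ne ht1 fun h1 => by
        subst h1; exact h 1 (by rw [hend, Int.cast_one])), h⟩⟩
    simp only [mem_filter, mem_range, id] at hm hmlast
    obtain ⟨hmt, hmint⟩ := hm
    have hm0 : m ≠ 0 := by
      rintro rfl
      exact hmint 0 (by simp)
    have hlater : ∀ u, m < u → u ≤ t → ∃ z : ℤ, (z : ℝ) = P (r + u) - P r := by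
      intro u hmu hut
      rcases hut.eq_or_lt with rfl | hut
      · exact ⟨1, by rw [hend, Int.cast_one]⟩
      · by_contra! hu
        exact absurd (hmlast u ⟨hut, hu⟩) (by omega)
    obtain ⟨r', hr', hr'r, hshift⟩ : ∃ r' < N, r' ≠ r ∧
        ∀ s, P (r' + s) - P r' = P (r + (m + s)) - P (r + m) := by
      rcases lt_or_ge (r + m) N with h | h
      · exact ⟨r + m, h, by omega, fun s => by rw [add_assoc]⟩
      · refine ⟨r + m - N, by omega, by omega, fun s => ?_⟩
        have h1 := hP (r + m - N)
        have h2 := hP (r + m - N + s)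
        rw [show r + m - N + N = r + m by omega] at h1
        rw [show r + m - N + s + N = r + (m + s) by omega] at h2
        linarith
    have hfin := hshift (t - m)
    rw [show m + (t - m) = t by omega] at hfin
    rcases lt_trichotomy (P (r + m) - P r) 0 with hneg | hzero | hpos
    · refine sum_range_le_sub_one_of_eq_zero hle hr' (totalValue_eq_zero fun u hu hhit' => ?_)
      have hu1 := (mem_Icc.1 hu).1
      have hhit1 := hhit'.1
      dsimp only at hhit1
      rw [hshift] at hhit1
      rcases le_or_gt (m + u) t with hle | hlt
      · obtain ⟨z, hz⟩ := hlater (m + u) (by omega) hle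
        exact hmint (z - 1) (by push_cast; linarith)
      · have := hhit'.2 (t - m) (by omega)
        dsimp only at this
        linarith
    · exact absurd hzero.symm (by simpa using hmint 0)
    · refine sum_range_le_sub_one_of_le_half hle hr hr' hr'r
        (totalValue_le_half fun u hu hhit' => ?_) (totalValue_le_half fun u hu hhit' => ?_)
      · obtain rfl := hhit'.firstHits.unique hhit
        exact (hhit'.2 m hmt).not_gt hpos
      · have hhit1 := hhit'.1
        dsimp only at hhit1
        rw [hshift] at hhit1
        rcases le_or_gt (m + u) t with hle | hlt
        · rcases hle.eq_or_lt with heq | hlt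
          · rw [heq] at hhit1
            linarith
          · linarith [hbefore _ hlt]
        · have := hhit'.2 (t - m) (by omega)
          dsimp only at this
          linarith [hbefore m hmt]

/-- Prefix sums of the sequence `a`. -/
def walk (a : ℕ → ℝ) (s : ℕ) : ℝ :=
  ∑ i ∈ range s, a i

lemma walk_add (a : ℕ → ℝ) (r s : ℕ) :
    walk a (r + s) - walk a r = walk (fun i => a (r + i)) s := by
  unfold walk
  rw [sum_range_add, add_sub_cancel_left]

lemma walk_mod_add_period (a : ℕ → ℝ) (t k : ℕ) :
    walk (fun i => a (i % t)) (k + t) = walk (fun i => a (i % t)) k + walk a t := by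
  have h := walk_add (fun i => a (i % t)) t k
  simp only [Nat.add_mod_left] at h
  have h' : walk (fun i => a (i % t)) t = walk a t :=
    sum_congr rfl fun i hi => congrArg a (Nat.mod_eq_of_lt (mem_range.1 hi))
  rw [add_comm k, ← h', ← h]
  ring

/-- Rotation by `r` of the first `t` elements of `Fin N`. -/
noncomputable def rotatePrefix {N t : ℕ} (ht : t ≤ N) (r : ℕ) : Equiv.Perm (Fin N) :=
  Equiv.ofBijective
    (fun k => if h : (k : ℕ) < t then
      ⟨(r + k) % t, (Nat.mod_lt _ (by omega)).trans_le ht⟩ else k)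
    (Finite.injective_iff_bijective.1 fun x y hxy => by
      have hx' : ∀ z : ℕ, z < t → (r + z) % t < t := fun z hz => Nat.mod_lt _ (by omega)
      split_ifs at hxy with hx hy hy
      · have h : r + x ≡ r + y [MOD t] := Fin.mk.inj hxy
        exact Fin.ext ((Nat.ModEq.add_left_cancel' r h).eq_of_lt_of_lt hx hy)
      · rw [← hxy] at hy
        exact absurd (hx' x hx) hy
      · rw [hxy] at hx
        exact absurd (hx' y hy) hx
      · exact hxy)

lemma rotatePrefix_apply_of_lt {N t : ℕ} (ht : t ≤ N) (r : ℕ) {k : Fin N} (hk : (k : ℕ) < t) :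
    (rotatePrefix ht r k : ℕ) = (r + k) % t := by
  simp [rotatePrefix, hk]

section Numberings

variable {ι : Type*} [Fintype ι] (c : ι → ℝ)

/-- The values of `c` listed in the order given by the numbering `e`, continued by zeros. -/
noncomputable def listing (e : Numbering ι) (k : ℕ) : ℝ :=
  if h : k < Fintype.card ι then c (e.symm ⟨k, h⟩) else 0

lemma listing_rotatePrefix {t : ℕ} (ht : t ≤ Fintype.card ι) (r : ℕ) (e : Numbering ι) {k : ℕ}
    (hk : k < t) :
    listing c (e.trans (rotatePrefix ht r).symm) k = listing c e ((r + k) % t) := by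
  have hmod : (r + k) % t < Fintype.card ι := (Nat.mod_lt _ (by omega)).trans_le ht
  rw [listing, listing, dif_pos (hk.trans_le ht), dif_pos hmod]
  congr 1
  rw [Equiv.symm_trans_apply, Equiv.symm_symm]
  congr 1
  exact Fin.ext (rotatePrefix_apply_of_lt ht r hk)

lemma walk_listing_rotatePrefix {t : ℕ} (ht : t ≤ Fintype.card ι) (r : ℕ) (e : Numbering ι)
    {s : ℕ} (hs : s ≤ t) :
    walk (listing c (e.trans (rotatePrefix ht r).symm)) s =
      walk (fun i => listing c e (i % t)) (r + s) - walk (fun i => listing c e (i % t)) r := by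
  rw [walk_add]
  exact sum_congr rfl fun i hi =>
    listing_rotatePrefix c ht r e ((mem_range.1 hi).trans_le hs)

lemma isPrefix_iff {e : Numbering ι} {S : Finset ι} {t : ℕ} (hS : #S = t) :
    e.IsPrefix S ↔ S = univ.filter fun i => (e i : ℕ) < t := by
  simp [Numbering.IsPrefix, Finset.ext_iff, hS]

lemma card_filter_numbering_lt (e : Numbering ι) {t : ℕ} (ht : t ≤ Fintype.card ι) :
    #(univ.filter fun i => (e i : ℕ) < t) = t := by
  have : #(univ.filter fun i => (e i : ℕ) < t) = #(range t) := by
    refine card_bij (fun i _ => (e i : ℕ)) (fun i hi => by simpa using hi)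
      (fun i _ j _ hij => e.injective (Fin.ext hij)) fun k hk => ?_
    exact ⟨e.symm ⟨k, (mem_range.1 hk).trans_le ht⟩, by simpa using hk, by simp⟩
  rw [this, card_range]

lemma walk_listing (e : Numbering ι) {t : ℕ} (ht : t ≤ Fintype.card ι) :
    walk (listing c e) t = ∑ i with (e i : ℕ) < t, c i := by
  symm
  refine sum_bij (fun i _ => (e i : ℕ)) (fun i hi => by simpa using hi)
    (fun i _ j _ hij => e.injective (Fin.ext hij)) (fun k hk => ?_) fun i _ => by simp [listing]
  exact ⟨e.symm ⟨k, (mem_range.1 hk).trans_le ht⟩, by simpa using hk, by simp⟩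

variable [DecidableEq ι]

lemma sum_numbering_trans (F : Numbering ι → ℝ) (σ : Equiv.Perm (Fin (Fintype.card ι))) :
    ∑ e : Numbering ι, F (e.trans σ) = ∑ e : Numbering ι, F e :=
  Equiv.sum_comp ((Equiv.refl ι).equivCongr σ) F

lemma card_mul_sum_eq_sum_rotatePrefix (F : Numbering ι → ℝ) {t : ℕ}
    (ht : t ≤ Fintype.card ι) :
    t * ∑ e : Numbering ι, F e =
      ∑ e : Numbering ι, ∑ r ∈ range t, F (e.trans (rotatePrefix ht r).symm) := by
  rw [sum_comm, sum_congr rfl fun r _ => sum_numbering_trans F (rotatePrefix ht r).symm,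
    sum_const, card_range, nsmul_eq_mul]

lemma sum_walk_eq_one_le {t : ℕ} (ht0 : 0 < t) (ht : t ≤ Fintype.card ι) :
    ∑ e : Numbering ι, (if walk (listing c e) t = 1 then (1 : ℝ) else 0) ≤
      t * ∑ e : Numbering ι, hitValue (walk (listing c e)) t := by
  rw [card_mul_sum_eq_sum_rotatePrefix _ ht]
  refine sum_le_sum fun e _ => ?_
  split_ifs with h
  · refine (one_le_sum_hitValue (P := walk fun i => listing c e (i % t)) ht0 fun k => ?_).trans_eq
      (sum_congr rfl fun r _ => hitValue_congr fun s hs => ?_)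
    · rw [walk_mod_add_period, h]
    · exact (walk_listing_rotatePrefix c ht r e hs).symm
  · exact sum_nonneg fun _ _ => hitValue_nonneg _ _

lemma card_mul_sum_totalValue_le [Nonempty ι]
    (h : ¬ ((∀ i, c i ≤ 1) ∧ 1 ≤ ∑ i, c i ∧ ∀ i, ∃ m : ℤ, (m : ℝ) = c i)) :
    Fintype.card ι *
        ∑ e : Numbering ι, totalValue (Fintype.card ι) (walk (listing c e)) ≤
      (Fintype.card ι).factorial * (Fintype.card ι - 1) := by
  rw [card_mul_sum_eq_sum_rotatePrefix _ le_rfl]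
  refine (sum_le_card_nsmul univ _ ((Fintype.card ι : ℝ) - 1) fun e _ => ?_).trans_eq ?_
  · set N := Fintype.card ι
    have hstep : ∀ i, walk (fun i => listing c e (i % N)) (e i + 1) -
        walk (fun i => listing c e (i % N)) (e i) = c i := fun i => by
      rw [walk_add, walk, sum_range_one, add_zero, Nat.mod_eq_of_lt (e i).2, listing,
        dif_pos (e i).2, Fin.eta, e.symm_apply_apply]
    have htotal : walk (listing c e) N = ∑ i, c i := by
      rw [walk, sum_range, ← Equiv.sum_comp e]
      exact sum_congr rfl fun i _ => by
        rw [listing, dif_pos (e i).2, Fin.eta, e.symm_apply_apply]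
    refine le_of_eq_of_le (sum_congr rfl fun r _ => sum_congr rfl fun t ht =>
      hitValue_congr fun s hs => walk_listing_rotatePrefix c le_rfl r e
        (hs.trans (mem_Icc.1 ht).2))
      (sum_totalValue_le (P := walk fun i => listing c e (i % N)) Fintype.card_pos
        (walk_mod_add_period _ _) ?_)
    by_contra! hcon
    obtain ⟨h1, h2, h3⟩ := hcon
    refine h ⟨fun i => ?_, htotal ▸ h2, fun i => ?_⟩
    · exact hstep i ▸ h1 (e i) (e i).2
    · exact hstep i ▸ h3 (e i) (e i).2
  · rw [card_univ, Fintype.card_numbering, nsmul_eq_mul]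

lemma sum_walk_eq_one {t : ℕ} (ht : t ≤ Fintype.card ι) :
    ∑ e : Numbering ι, (if walk (listing c e) t = 1 then (1 : ℝ) else 0) =
      ∑ S ∈ powersetCard t univ, if ∑ i ∈ S, c i = 1 then
        (t.factorial * (Fintype.card ι - t).factorial : ℝ) else 0 := by
  have hfib : ∀ e : Numbering ι, (if walk (listing c e) t = 1 then (1 : ℝ) else 0) =
      ∑ S ∈ powersetCard t univ, if ∑ i ∈ S, c i = 1 then
        (if e ∈ Numbering.prefixed S then (1 : ℝ) else 0) else 0 := by
    intro e
    rw [sum_eq_single_of_mem (univ.filter fun i => (e i : ℕ) < t)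
      (mem_powersetCard.2 ⟨subset_univ _, card_filter_numbering_lt e ht⟩)]
    · rw [walk_listing c e ht, if_pos (Numbering.mem_prefixed.2
        ((isPrefix_iff (card_filter_numbering_lt e ht)).2 rfl))]
    · intro S hS hne
      rw [if_neg fun h => hne ((isPrefix_iff (mem_powersetCard.1 hS).2).1
        (Numbering.mem_prefixed.1 h)), ite_self]
  rw [sum_congr rfl fun e _ => hfib e, sum_comm]
  refine sum_congr rfl fun S hS => ?_
  split_ifs
  · rw [sum_boole, filter_mem_eq_inter, univ_inter, Numbering.card_prefixed,
      (mem_powersetCard.1 hS).2, Nat.cast_mul]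
  · exact sum_const_zero

end Numberings

open scoped Classical in
lemma factorial_mul_hyperplaneWeight {n : ℕ} (c : Fin n → ℝ) :
    n.factorial * hyperplaneWeight c =
      ∑ t ∈ Icc 1 n, (t : ℝ)⁻¹ * ∑ S ∈ powersetCard t (univ : Finset (Fin n)),
        if ∑ i ∈ S, c i = 1 then (t.factorial * (n - t).factorial : ℝ) else 0 := by
  rw [hyperplaneWeight, mul_sum, ← sum_filter_add_sum_filter_not univ Finset.Nonempty]
  rw [sum_eq_zero (s := univ.filter fun S : Finset (Fin n) => ¬ S.Nonempty) fun S hS => by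
    rw [if_neg fun h => (mem_filter.1 hS).2 h.1, mul_zero], add_zero]
  rw [← sum_fiberwise_of_maps_to (t := Icc 1 n) (g := card) fun S hS =>
    mem_Icc.2 ⟨(mem_filter.1 hS).2.card_pos, card_finset_fin_le S⟩]
  refine sum_congr rfl fun t ht => ?_
  obtain ⟨ht1, htn⟩ := mem_Icc.1 ht
  rw [mul_sum]
  refine sum_congr ?_ fun S hS => ?_
  · ext S
    simp only [mem_filter, mem_univ, true_and, mem_powersetCard, subset_univ, and_iff_right_iff_imp]
    rintro rfl
    exact card_pos.1 ht1
  · obtain ⟨-, hcard⟩ := mem_powersetCard.1 hS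
    have hne : S.Nonempty := card_pos.1 (hcard ▸ ht1)
    have ht0 : (t : ℝ) ≠ 0 := by positivity
    simp only [hne, true_and, hcard, mul_ite, mul_zero]
    refine if_congr Iff.rfl ?_ rfl
    rw [← Nat.choose_mul_factorial_mul_factorial htn]
    have : (n.choose t : ℝ) ≠ 0 := by exact_mod_cast (Nat.choose_pos htn).ne'
    push_cast
    field_simp

theorem weight_le_one_sub_inv_of_not_conditions (n : ℕ) (hn : 1 ≤ n) (c : Fin n → ℝ)
    (h : ¬ ((∀ i, c i ≤ 1) ∧ 1 ≤ ∑ i, c i ∧ ∀ i, ∃ m : ℤ, (m : ℝ) = c i)) :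
    hyperplaneWeight c ≤ 1 - 1 / n := by
  have : Nonempty (Fin n) := ⟨⟨0, hn⟩⟩
  have hn0 : (0 : ℝ) < n := by exact_mod_cast hn
  have hle : n.factorial * hyperplaneWeight c ≤
      ∑ e : Numbering (Fin n), totalValue (Fintype.card (Fin n)) (walk (listing c e)) := by
    have hIcc : Icc 1 n = Icc 1 (Fintype.card (Fin n)) := by rw [Fintype.card_fin]
    rw [factorial_mul_hyperplaneWeight, hIcc]
    simp only [totalValue]
    rw [sum_comm]
    refine sum_le_sum fun t ht => ?_
    obtain ⟨ht1, hcard⟩ := mem_Icc.1 ht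
    rw [inv_mul_le_iff₀ (by exact_mod_cast ht1)]
    refine le_of_eq_of_le ?_ (sum_walk_eq_one_le c ht1 hcard)
    rw [sum_walk_eq_one c hcard, Fintype.card_fin]
  have htotal := card_mul_sum_totalValue_le c h
  generalize ∑ e : Numbering (Fin n), totalValue _ (walk (listing c e)) = X at hle htotal
  rw [Fintype.card_fin] at htotal
  have hfac : (0 : ℝ) < n.factorial := by exact_mod_cast n.factorial_pos
  have hmul : n.factorial * (n * hyperplaneWeight c) ≤ n.factorial * ((n : ℝ) - 1) := by
    calc n.factorial * (n * hyperplaneWeight c)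
        = n * (n.factorial * hyperplaneWeight c) := by ring
      _ ≤ _ := mul_le_mul_of_nonneg_left hle hn0.le
      _ ≤ _ := htotal
  have hlast := le_of_mul_le_mul_left hmul hfac
  rw [one_sub_div hn0.ne', le_div_iff₀ hn0]
  linarith
end

section
/- For every n ≥ 1, the number of vectors c ∈ ℤ^n satisfying c_i ≤ 1 for all i and ∑_{i=1}^n c_i ≥ 1 is exactly binom(2n−1, n). Consequently, the number of weight-1 hyperplanes in ℝ^n is binom(2n−1, n). -/
namespace Numbering

variable {α : Type*} [Fintype α]

/-- The sum of `c` over the first `k` elements in the ordering `f`. -/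
noncomputable def prefixSum (c : α → ℝ) (f : Numbering α) (k : ℕ) : ℝ :=
  ∑ x with (f x : ℕ) < k, c x

/-- The value of `c` at the `i`-th element in the ordering `f`, or `0` if there is none. -/
noncomputable def step (c : α → ℝ) (f : Numbering α) (i : ℕ) : ℝ :=
  if h : i < Fintype.card α then c (f.symm ⟨i, h⟩) else 0

theorem step_apply (c : α → ℝ) (f : Numbering α) (x : α) : step c f (f x) = c x := by
  simp [step]

theorem prefixSum_eq_sum_step (c : α → ℝ) (f : Numbering α) (k : ℕ) :
    prefixSum c f k = ∑ i ∈ Finset.range k, step c f i := by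
  have h : prefixSum c f k = ∑ i ∈ Finset.range k with i < Fintype.card α, step c f i := by
    refine Finset.sum_bij (fun x _ ↦ (f x : ℕ)) ?_ ?_ ?_ ?_
    · intro x hx
      simpa using hx
    · intro x _ y _ hxy
      exact f.injective (Fin.ext hxy)
    · intro i hi
      simp only [Finset.mem_filter, Finset.mem_range] at hi
      exact ⟨f.symm ⟨i, hi.2⟩, by simpa using hi.1, by simp⟩
    · intro x _
      exact (step_apply c f x).symm
  rw [h, Finset.sum_filter_of_ne]
  intro i _ hi
  by_contra hlt
  exact hi (by simp [step, hlt])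

/-- The first-passage property: the partial sums along `f` are below `1` before time `k`,
and equal to `1` at time `k`. -/
def IsFirstPassage (c : α → ℝ) (f : Numbering α) (k : ℕ) : Prop :=
  prefixSum c f k = 1 ∧ ∀ j, 0 < j → j < k → prefixSum c f j < 1

theorem IsFirstPassage.eq {c : α → ℝ} {f : Numbering α} {k l : ℕ} (hk : 0 < k) (hl : 0 < l)
    (h : IsFirstPassage c f k) (h' : IsFirstPassage c f l) : k = l := by
  rcases lt_trichotomy k l with hkl | rfl | hkl
  · exact absurd h.1 (h'.2 k hk hkl).ne
  · rfl
  · exact absurd h'.1 (h.2 l hl hkl).ne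

/-- The permutation of `Fin m` shifting the first `k` elements cyclically by `r`
(and the identity if `m < k`). -/
noncomputable def rotatePrefix (m k r : ℕ) : Equiv.Perm (Fin m) :=
  Equiv.ofBijective
    (fun i ↦ if h : (i : ℕ) < k ∧ k ≤ m then
      ⟨(r + i) % k, (Nat.mod_lt _ (by omega)).trans_le h.2⟩ else i) <| by
    rw [← Finite.injective_iff_bijective]
    intro i j hij
    have hmod : ∀ a : ℕ, a < k → (r + a) % k < k := fun a ha ↦ Nat.mod_lt _ (by omega)
    by_cases hkm : k ≤ m
    · by_cases hi : (i : ℕ) < k <;> by_cases hj : (j : ℕ) < k <;>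
        simp only [hi, hj, hkm, and_self, and_true, dite_true, dite_false, Fin.ext_iff] at hij
      · have h : (i : ℕ) ≡ j [MOD k] := Nat.ModEq.add_left_cancel' r hij
        exact Fin.ext (h.eq_of_lt_of_lt hi hj)
      · have := hmod i hi
        omega
      · have := hmod j hj
        omega
      · exact Fin.ext hij
    · simpa [hkm] using hij

theorem rotatePrefix_apply {m k : ℕ} (r : ℕ) (hkm : k ≤ m) (i : Fin m) (hi : (i : ℕ) < k) :
    (rotatePrefix m k r i : ℕ) = (r + i) % k := by
  simp [rotatePrefix, hi, hkm]

/-- Reorder the first `k` elements of `f` by a cyclic shift starting at position `r`. -/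
noncomputable def rotate (k r : ℕ) (f : Numbering α) : Numbering α :=
  f.trans (rotatePrefix (Fintype.card α) k r).symm

theorem bijective_rotate (k r : ℕ) : Function.Bijective (rotate (α := α) k r) :=
  ((Equiv.refl α).equivCongr (rotatePrefix (Fintype.card α) k r).symm).bijective

theorem step_rotate (c : α → ℝ) (f : Numbering α) {k i : ℕ} (r : ℕ) (hk : k ≤ Fintype.card α)
    (hi : i < k) : step c (rotate k r f) i = step c f ((r + i) % k) := by
  have h1 : i < Fintype.card α := hi.trans_le hk
  have h2 : (r + i) % k < Fintype.card α := (Nat.mod_lt _ (by omega)).trans_le hk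
  have h3 : rotatePrefix (Fintype.card α) k r ⟨i, h1⟩ = ⟨(r + i) % k, h2⟩ :=
    Fin.ext (rotatePrefix_apply r hk ⟨i, h1⟩ hi)
  simp [step, h1, h2, rotate, h3]

/-- The partial sums of the periodic sequence repeating the first `k` steps of `f`. -/
noncomputable def periodicSum (c : α → ℝ) (f : Numbering α) (k m : ℕ) : ℝ :=
  ∑ i ∈ Finset.range m, step c f (i % k)

theorem periodicSum_of_le (c : α → ℝ) (f : Numbering α) {k j : ℕ} (hj : j ≤ k) :
    periodicSum c f k j = prefixSum c f j := by
  rw [prefixSum_eq_sum_step, periodicSum]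
  refine Finset.sum_congr rfl fun i hi ↦ ?_
  rw [Nat.mod_eq_of_lt ((Finset.mem_range.1 hi).trans_le hj)]

theorem periodicSum_add (c : α → ℝ) (f : Numbering α) (k m : ℕ) :
    periodicSum c f k (k + m) = prefixSum c f k + periodicSum c f k m := by
  rw [← periodicSum_of_le c f le_rfl]
  simp [periodicSum, Finset.sum_range_add]

theorem prefixSum_rotate (c : α → ℝ) (f : Numbering α) {k j : ℕ} (r : ℕ)
    (hk : k ≤ Fintype.card α) (hj : j ≤ k) :
    prefixSum c (rotate k r f) j = periodicSum c f k (r + j) - periodicSum c f k r := by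
  rw [prefixSum_eq_sum_step, periodicSum, periodicSum, Finset.sum_range_add, add_sub_cancel_left]
  refine Finset.sum_congr rfl fun i hi ↦ ?_
  exact step_rotate c f r hk ((Finset.mem_range.1 hi).trans_le hj)

theorem prefixSum_rotate_self (c : α → ℝ) (f : Numbering α) {k : ℕ} (r : ℕ)
    (hk : k ≤ Fintype.card α) : prefixSum c (rotate k r f) k = prefixSum c f k := by
  rw [prefixSum_rotate c f r hk le_rfl, add_comm r k, periodicSum_add, add_sub_cancel_right]

/-- Partial sums of a rotated ordering before the shift wraps around. -/
theorem prefixSum_rotate_of_le (c : α → ℝ) (f : Numbering α) {k j r : ℕ}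
    (hk : k ≤ Fintype.card α) (hj : r + j ≤ k) :
    prefixSum c (rotate k r f) j = prefixSum c f (r + j) - prefixSum c f r := by
  rw [prefixSum_rotate c f r hk (by omega), periodicSum_of_le c f hj,
    periodicSum_of_le c f (by omega)]

/-- Partial sums of a rotated ordering after the shift wraps around. -/
theorem prefixSum_rotate_sub_add (c : α → ℝ) (f : Numbering α) {k r i : ℕ}
    (hk : k ≤ Fintype.card α) (hi : i ≤ r) (hr : r ≤ k) :
    prefixSum c (rotate k r f) (k - r + i) =
      prefixSum c f k + prefixSum c f i - prefixSum c f r := by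
  rw [prefixSum_rotate c f r hk (by omega), show r + (k - r + i) = k + i by omega,
    periodicSum_add, periodicSum_of_le c f hr, periodicSum_of_le c f (by omega)]

/-- Some rotation of a sequence of sum `1` has all proper partial sums below `1`. -/
theorem exists_isFirstPassage_rotate {c : α → ℝ} {f : Numbering α} {k : ℕ} (hk0 : 0 < k)
    (hk : k ≤ Fintype.card α) (hf : prefixSum c f k = 1) :
    ∃ r < k, IsFirstPassage c (rotate k r f) k := by
  obtain ⟨s, hs, hmax⟩ := (Finset.range k).exists_max_image (prefixSum c f) ⟨0, by simpa⟩
  have hex : ∃ r, r < k ∧ prefixSum c f r = prefixSum c f s := ⟨s, by simpa using hs, rfl⟩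
  classical
  obtain ⟨hrk, hr⟩ := Nat.find_spec hex
  set r := Nat.find hex
  have hle : ∀ i < k, prefixSum c f i ≤ prefixSum c f r := fun i hi ↦ by
    rw [hr]; exact hmax i (by simpa)
  have hlt : ∀ i < r, prefixSum c f i < prefixSum c f r := fun i hi ↦
    lt_of_le_of_ne (hle i (by omega)) fun h ↦ Nat.find_min hex hi ⟨by omega, h.trans hr⟩
  refine ⟨r, hrk, (prefixSum_rotate_self c f r hk).trans hf, fun j hj0 hjk ↦ ?_⟩
  rcases lt_or_ge (r + j) k with h | h
  · rw [prefixSum_rotate_of_le c f hk h.le]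
    linarith [hle _ h]
  · obtain ⟨i, rfl⟩ : ∃ i, j = k - r + i := ⟨j - (k - r), by omega⟩
    rw [prefixSum_rotate_sub_add c f hk (by omega) hrk.le, hf]
    linarith [hlt i (by omega)]

open scoped Classical in
/-- The number of rotations of the first `k` elements of `f` with first passage at time `k`. -/
noncomputable def numPassages (c : α → ℝ) (f : Numbering α) (k : ℕ) : ℕ :=
  (Finset.range k |>.filter fun r ↦ IsFirstPassage c (rotate k r f) k).card

theorem one_le_numPassages {c : α → ℝ} {f : Numbering α} {k : ℕ} (hk0 : 0 < k)
    (hk : k ≤ Fintype.card α) (hf : prefixSum c f k = 1) : 1 ≤ numPassages c f k := by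
  obtain ⟨r, hr, h⟩ := exists_isFirstPassage_rotate hk0 hk hf
  exact Finset.card_pos.2 ⟨r, by simp [hr, h]⟩

open scoped Classical in
theorem sum_isFirstPassage (c : α → ℝ) {k : ℕ} (hk0 : 0 < k) (hk : k ≤ Fintype.card α) :
    ∑ f : Numbering α, (if IsFirstPassage c f k then (1 : ℝ) else 0) =
      ∑ f : Numbering α, if prefixSum c f k = 1 then (numPassages c f k : ℝ) / k else 0 := by
  have h1 : ∀ f : Numbering α, (if prefixSum c f k = 1 then (numPassages c f k : ℝ) / k else 0) =
      (∑ r ∈ Finset.range k, if IsFirstPassage c (rotate k r f) k then (1 : ℝ) else 0) / k := by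
    intro f
    rw [Finset.sum_boole]
    split_ifs with hf
    · rfl
    · rw [Finset.filter_false_of_mem]
      · simp
      · exact fun r _ h ↦ hf ((prefixSum_rotate_self c f r hk).symm.trans h.1)
  have h2 : ∀ r, ∑ f : Numbering α, (if IsFirstPassage c (rotate k r f) k then (1 : ℝ) else 0) =
      ∑ f : Numbering α, if IsFirstPassage c f k then (1 : ℝ) else 0 := fun r ↦
    (bijective_rotate k r).sum_comp fun f ↦ if IsFirstPassage c f k then (1 : ℝ) else 0
  have hk' : (k : ℝ) ≠ 0 := by positivity
  simp_rw [h1]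
  rw [← Finset.sum_div, Finset.sum_comm, Finset.sum_congr rfl fun r _ ↦ h2 r]
  simp only [Finset.sum_const, Finset.card_range, nsmul_eq_mul]
  field_simp

theorem isPrefix_iff_eq_filter {f : Numbering α} {S : Finset α} :
    IsPrefix f S ↔ S = Finset.univ.filter fun x ↦ (f x : ℕ) < S.card := by
  simp [IsPrefix, Finset.ext_iff]

theorem card_filter_lt (f : Numbering α) {k : ℕ} (hk : k ≤ Fintype.card α) :
    (Finset.univ.filter fun x ↦ (f x : ℕ) < k).card = k := by
  have h : (Finset.univ.filter fun x ↦ (f x : ℕ) < k).card =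
      (Finset.univ.filter fun i : Fin (Fintype.card α) ↦ (i : ℕ) < k).card :=
    Finset.card_bijective f f.bijective (by simp)
  rw [h, Fin.card_filter_val_lt, min_eq_right hk]

open scoped Classical in
/-- Summing over the nonempty prefixes of an ordering is summing over their lengths. -/
theorem sum_isPrefix (c : α → ℝ) (f : Numbering α) :
    ∑ S : Finset α, (if IsPrefix f S then
      (if S.Nonempty ∧ ∑ x ∈ S, c x = 1 then 1 / (S.card : ℝ) else 0) else 0) =
    ∑ k ∈ Finset.Icc 1 (Fintype.card α), if prefixSum c f k = 1 then 1 / (k : ℝ) else 0 := by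
  have h : ∀ S : Finset α, (if IsPrefix f S then
      (if S.Nonempty ∧ ∑ x ∈ S, c x = 1 then 1 / (S.card : ℝ) else 0) else 0) =
      if IsPrefix f S ∧ S.Nonempty then
        (if ∑ x ∈ S, c x = 1 then 1 / (S.card : ℝ) else 0) else 0 := by
    intro S
    by_cases h1 : IsPrefix f S <;> by_cases h2 : S.Nonempty <;> simp [h1, h2]
  rw [Finset.sum_congr rfl fun S _ ↦ h S, ← Finset.sum_filter]
  refine Finset.sum_bij (fun S _ ↦ S.card) ?_ ?_ ?_ ?_
  · intro S hS
    simp only [Finset.mem_filter, Finset.mem_univ, true_and] at hS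
    exact Finset.mem_Icc.2 ⟨hS.2.card_pos, S.card_le_univ⟩
  · intro S hS T hT hST
    simp only [Finset.mem_filter, Finset.mem_univ, true_and] at hS hT
    rw [isPrefix_iff_eq_filter.1 hS.1, isPrefix_iff_eq_filter.1 hT.1, hST]
  · intro k hk
    rw [Finset.mem_Icc] at hk
    have hcard := card_filter_lt f hk.2
    refine ⟨Finset.univ.filter fun x ↦ (f x : ℕ) < k, ?_, hcard⟩
    simp only [Finset.mem_filter, Finset.mem_univ, true_and]
    exact ⟨isPrefix_iff_eq_filter.2 (by rw [hcard]), Finset.card_pos.1 (by omega)⟩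
  · intro S hS
    simp only [Finset.mem_filter, Finset.mem_univ, true_and] at hS
    rw [prefixSum, ← isPrefix_iff_eq_filter.1 hS.1]

open scoped Classical in
theorem factorial_mul_sum_weight (c : α → ℝ) :
    ((Fintype.card α).factorial : ℝ) * ∑ S : Finset α,
      (if S.Nonempty ∧ ∑ x ∈ S, c x = 1 then
        1 / ((S.card : ℝ) * (Fintype.card α).choose S.card) else 0) =
    ∑ f : Numbering α, ∑ k ∈ Finset.Icc 1 (Fintype.card α),
      if prefixSum c f k = 1 then 1 / (k : ℝ) else 0 := by
  simp_rw [← sum_isPrefix]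
  rw [Finset.sum_comm, Finset.mul_sum]
  refine Finset.sum_congr rfl fun S _ ↦ ?_
  rw [← Finset.sum_filter, Finset.sum_const]
  have h : (Finset.univ.filter fun f : Numbering α ↦ IsPrefix f S).card =
      S.card.factorial * (Fintype.card α - S.card).factorial := by
    rw [← card_prefixed]
    congr 1
  rw [h, nsmul_eq_mul]
  split_ifs with hS
  · have h1 : (Fintype.card α).choose S.card * S.card.factorial *
        (Fintype.card α - S.card).factorial = (Fintype.card α).factorial :=
      Nat.choose_mul_factorial_mul_factorial S.card_le_univ
    have h2 : (0 : ℝ) < (Fintype.card α).choose S.card := by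
      exact_mod_cast Nat.choose_pos S.card_le_univ
    have h3 : (0 : ℝ) < S.card := by exact_mod_cast hS.1.card_pos
    rw [← h1]
    push_cast
    field_simp
  · simp

open scoped Classical in
/-- An ordering has at most one first-passage time. -/
theorem sum_isFirstPassage_le_one (c : α → ℝ) (f : Numbering α) :
    ∑ k ∈ Finset.Icc 1 (Fintype.card α), (if IsFirstPassage c f k then (1 : ℝ) else 0) ≤ 1 := by
  rw [Finset.sum_boole]
  have : ((Finset.Icc 1 (Fintype.card α)).filter fun k ↦ IsFirstPassage c f k).card ≤ 1 := by
    rw [Finset.card_le_one]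
    intro k hk l hl
    simp only [Finset.mem_filter, Finset.mem_Icc] at hk hl
    exact hk.2.eq (by omega) (by omega) hl.2
  exact_mod_cast this

open scoped Classical in
theorem sum_isFirstPassage_eq_one_iff (c : α → ℝ) (f : Numbering α) :
    ∑ k ∈ Finset.Icc 1 (Fintype.card α), (if IsFirstPassage c f k then (1 : ℝ) else 0) = 1 ↔
      ∃ k, 0 < k ∧ k ≤ Fintype.card α ∧ IsFirstPassage c f k := by
  constructor
  · intro h
    by_contra! hne
    rw [Finset.sum_eq_zero] at h
    · exact zero_ne_one h
    · intro k hk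
      rw [Finset.mem_Icc] at hk
      exact if_neg (hne k (by omega) hk.2)
  · rintro ⟨k, hk0, hk, h⟩
    refine le_antisymm (sum_isFirstPassage_le_one c f) ?_
    have := Finset.single_le_sum
      (f := fun k ↦ if IsFirstPassage c f k then (1 : ℝ) else 0)
      (fun i _ ↦ by split_ifs <;> norm_num) (Finset.mem_Icc.2 ⟨hk0, hk⟩)
    simpa [h] using this

open scoped Classical in
/-- The weight of `c` is `1` exactly when every ordering has a first passage and every
segment of sum `1` has a unique rotation with first passage at its end. -/
theorem sum_weight_eq_one_iff (c : α → ℝ) :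
    ∑ S : Finset α, (if S.Nonempty ∧ ∑ x ∈ S, c x = 1 then
        1 / ((S.card : ℝ) * (Fintype.card α).choose S.card) else 0) = 1 ↔
      ∀ f : Numbering α, (∃ k, 0 < k ∧ k ≤ Fintype.card α ∧ IsFirstPassage c f k) ∧
        ∀ k, 0 < k → k ≤ Fintype.card α → prefixSum c f k = 1 → numPassages c f k = 1 := by
  set W := ∑ S : Finset α, (if S.Nonempty ∧ ∑ x ∈ S, c x = 1 then
        1 / ((S.card : ℝ) * (Fintype.card α).choose S.card) else 0) with hW
  have hfact : (0 : ℝ) < (Fintype.card α).factorial := by positivity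
  have hsum : ∑ f : Numbering α, ∑ k ∈ Finset.Icc 1 (Fintype.card α),
      (if IsFirstPassage c f k then (1 : ℝ) else 0) =
      ∑ f : Numbering α, ∑ k ∈ Finset.Icc 1 (Fintype.card α),
        if prefixSum c f k = 1 then (numPassages c f k : ℝ) / k else 0 := by
    rw [Finset.sum_comm, Finset.sum_comm (s := (Finset.univ : Finset (Numbering α)))]
    refine Finset.sum_congr rfl fun k hk ↦ ?_
    rw [Finset.mem_Icc] at hk
    exact sum_isFirstPassage c (by omega) hk.2
  have key : ((Fintype.card α).factorial : ℝ) * (1 - W) =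
      ∑ f : Numbering α, ((1 - ∑ k ∈ Finset.Icc 1 (Fintype.card α),
        (if IsFirstPassage c f k then (1 : ℝ) else 0)) +
        ∑ k ∈ Finset.Icc 1 (Fintype.card α),
          if prefixSum c f k = 1 then ((numPassages c f k : ℝ) - 1) / k else 0) := by
    have h1 : ∀ (f : Numbering α) (k : ℕ),
        (if prefixSum c f k = 1 then ((numPassages c f k : ℝ) - 1) / k else 0) =
        (if prefixSum c f k = 1 then (numPassages c f k : ℝ) / k else 0) -
          (if prefixSum c f k = 1 then 1 / (k : ℝ) else 0) := by
      intro f k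
      split_ifs <;> ring
    simp_rw [h1, Finset.sum_add_distrib, Finset.sum_sub_distrib]
    rw [hsum, ← factorial_mul_sum_weight, ← hW]
    simp only [Finset.sum_const, Finset.card_univ, Fintype.card_numbering, nsmul_eq_mul]
    ring
  have hnonneg : ∀ (f : Numbering α), ∀ k ∈ Finset.Icc 1 (Fintype.card α),
      0 ≤ if prefixSum c f k = 1 then ((numPassages c f k : ℝ) - 1) / k else 0 := by
    intro f k hk
    rw [Finset.mem_Icc] at hk
    split_ifs with h
    · have : (1 : ℝ) ≤ numPassages c f k := by
        exact_mod_cast one_le_numPassages (by omega) hk.2 h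
      exact div_nonneg (by linarith) (by positivity)
    · exact le_rfl
  have hW1 : W = 1 ↔ ((Fintype.card α).factorial : ℝ) * (1 - W) = 0 := by
    rw [mul_eq_zero, or_iff_right hfact.ne', sub_eq_zero, eq_comm]
  rw [hW1, key, Finset.sum_eq_zero_iff_of_nonneg fun f _ ↦ add_nonneg
    (sub_nonneg.2 (sum_isFirstPassage_le_one c f)) (Finset.sum_nonneg (hnonneg f))]
  refine ⟨fun h f ↦ ?_, fun h f _ ↦ ?_⟩
  · have := h f (Finset.mem_univ f)
    rw [add_eq_zero_iff_of_nonneg (sub_nonneg.2 (sum_isFirstPassage_le_one c f))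
      (Finset.sum_nonneg (hnonneg f)), sub_eq_zero, eq_comm, sum_isFirstPassage_eq_one_iff,
      Finset.sum_eq_zero_iff_of_nonneg (hnonneg f)] at this
    refine ⟨this.1, fun k hk0 hk hf ↦ ?_⟩
    have h2 := this.2 k (Finset.mem_Icc.2 ⟨hk0, hk⟩)
    have hk' : (k : ℝ) ≠ 0 := by positivity
    rw [if_pos hf, div_eq_zero_iff, or_iff_left hk', sub_eq_zero] at h2
    exact_mod_cast h2
  · rw [(sum_isFirstPassage_eq_one_iff c f).2 (h f).1, sub_self, zero_add]
    refine Finset.sum_eq_zero fun k hk ↦ ?_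
    rw [Finset.mem_Icc] at hk
    split_ifs with hf
    · simp [(h f).2 k (by omega) hk.2 hf]
    · rfl

theorem prefixSum_zero (c : α → ℝ) (f : Numbering α) : prefixSum c f 0 = 0 := by
  simp [prefixSum]

theorem prefixSum_card (c : α → ℝ) (f : Numbering α) :
    prefixSum c f (Fintype.card α) = ∑ x, c x := by
  simp [prefixSum]

theorem prefixSum_succ (c : α → ℝ) (f : Numbering α) (k : ℕ) :
    prefixSum c f (k + 1) = prefixSum c f k + step c f k := by
  simp [prefixSum_eq_sum_step, Finset.sum_range_succ]

theorem prefixSum_intCast_nonpos {z : α → ℤ} {f : Numbering α} {k : ℕ}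
    (h : prefixSum (fun x ↦ (z x : ℝ)) f k < 1) : prefixSum (fun x ↦ (z x : ℝ)) f k ≤ 0 := by
  rw [prefixSum, ← Int.cast_sum] at h ⊢
  have h' : ∑ x with (f x : ℕ) < k, z x < 1 := by exact_mod_cast h
  exact_mod_cast Int.lt_add_one_iff.1 h'

theorem exists_isFirstPassage_intCast {z : α → ℤ} (hle : ∀ x, z x ≤ 1) (hsum : 1 ≤ ∑ x, z x)
    (f : Numbering α) :
    ∃ k, 0 < k ∧ k ≤ Fintype.card α ∧ IsFirstPassage (fun x ↦ (z x : ℝ)) f k := by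
  classical
  have hN : 1 ≤ prefixSum (fun x ↦ (z x : ℝ)) f (Fintype.card α) := by
    rw [prefixSum_card]
    exact_mod_cast hsum
  have hex : ∃ k, 1 ≤ prefixSum (fun x ↦ (z x : ℝ)) f k := ⟨_, hN⟩
  have hspec := Nat.find_spec hex
  have hmin : ∀ j < Nat.find hex, prefixSum (fun x ↦ (z x : ℝ)) f j < 1 := fun j hj ↦
    not_le.1 (Nat.find_min hex hj)
  have hfind : Nat.find hex ≤ Fintype.card α := Nat.find_min' hex hN
  obtain ⟨m, hm⟩ : ∃ m, Nat.find hex = m + 1 := by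
    refine Nat.exists_eq_succ_of_ne_zero fun h0 ↦ ?_
    rw [h0, prefixSum_zero] at hspec
    linarith
  rw [hm] at hspec hmin hfind
  refine ⟨m + 1, m.succ_pos, hfind, le_antisymm ?_ hspec, fun j _ hj ↦ hmin j hj⟩
  have h1 := prefixSum_intCast_nonpos (hmin m m.lt_succ_self)
  have h2 : step (fun x ↦ (z x : ℝ)) f m ≤ 1 := by
    rw [step, dif_pos (by omega)]
    exact_mod_cast hle _
  rw [prefixSum_succ]
  linarith

theorem numPassages_intCast {z : α → ℤ} {f : Numbering α} {k : ℕ} (hk0 : 0 < k)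
    (hk : k ≤ Fintype.card α) (hf : prefixSum (fun x ↦ (z x : ℝ)) f k = 1) :
    numPassages (fun x ↦ (z x : ℝ)) f k = 1 := by
  refine le_antisymm ?_ (one_le_numPassages hk0 hk hf)
  have key : ∀ r s, r < s → s < k → IsFirstPassage (fun x ↦ (z x : ℝ)) (rotate k r f) k →
      ¬ IsFirstPassage (fun x ↦ (z x : ℝ)) (rotate k s f) k := by
    intro r s hrs hsk hr hs
    have h1 := prefixSum_intCast_nonpos (hr.2 (s - r) (by omega) (by omega))
    have h2 := prefixSum_intCast_nonpos (hs.2 (k - s + r) (by omega) (by omega))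
    rw [prefixSum_rotate_of_le _ f hk (by omega), show r + (s - r) = s by omega] at h1
    rw [prefixSum_rotate_sub_add _ f hk hrs.le hsk.le, hf] at h2
    linarith
  rw [numPassages, Finset.card_le_one]
  intro r hr s hs
  simp only [Finset.mem_filter, Finset.mem_range] at hr hs
  rcases lt_trichotomy r s with h | h | h
  · exact absurd hs.2 (key r s h hs.1 hr.2)
  · exact h
  · exact absurd hr.2 (key s r h hr.1 hs.2)

/-- If only one rotation has first passage at `k`, then the partial sums before the first
passage are nonpositive. -/
theorem IsFirstPassage.nonpos {c : α → ℝ} {f : Numbering α} {k : ℕ}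
    (hk : k ≤ Fintype.card α) (h : IsFirstPassage c f k) (hnum : numPassages c f k = 1)
    {j : ℕ} (hjk : j < k) : prefixSum c f j ≤ 0 := by
  classical
  by_contra! hpos
  have hex : ∃ r, 0 < prefixSum c f r := ⟨j, hpos⟩
  have hspec := Nat.find_spec hex
  have hrj : Nat.find hex ≤ j := Nat.find_min' hex hpos
  have hmin : ∀ i < Nat.find hex, prefixSum c f i ≤ 0 := fun i hi ↦
    not_lt.1 (Nat.find_min hex hi)
  set r := Nat.find hex
  have hr0 : r ≠ 0 := fun h0 ↦ by
    rw [h0, prefixSum_zero] at hspec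
    exact hspec.false
  have hr : IsFirstPassage c (rotate k r f) k := by
    refine ⟨(prefixSum_rotate_self c f r hk).trans h.1, fun i hi0 hik ↦ ?_⟩
    rcases lt_or_ge (r + i) k with hi | hi
    · rw [prefixSum_rotate_of_le c f hk hi.le]
      linarith [h.2 (r + i) (by omega) hi]
    · obtain ⟨l, rfl⟩ : ∃ l, i = k - r + l := ⟨i - (k - r), by omega⟩
      rw [prefixSum_rotate_sub_add c f hk (by omega) (by omega), h.1]
      linarith [hmin l (by omega)]
  have h0 : IsFirstPassage c (rotate k 0 f) k := by
    have hrot : ∀ i ≤ k, prefixSum c (rotate k 0 f) i = prefixSum c f i := fun i hi ↦ by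
      rw [prefixSum_rotate_of_le c f hk (by omega), prefixSum_zero, zero_add, sub_zero]
    refine ⟨(hrot k le_rfl).trans h.1, fun i hi0 hik ↦ ?_⟩
    rw [hrot i hik.le]
    exact h.2 i hi0 hik
  refine hr0 (Finset.card_le_one.1 hnum.le r ?_ 0 ?_)
  · simp [hr, hrj.trans_lt hjk]
  · simp [h0, (Nat.zero_le j).trans_lt hjk]

/-- Elements can be ordered compatibly with any priority function. -/
theorem exists_lt_of_lt (φ : α → ℕ) :
    ∃ f : Numbering α, ∀ x y, φ x < φ y → f x < f y := by
  let e := Fintype.equivFin α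
  let σ := Tuple.sort (φ ∘ e.symm)
  refine ⟨e.trans σ.symm, fun x y hxy ↦ ?_⟩
  by_contra! hle
  have hmono : Monotone ((φ ∘ e.symm) ∘ σ) := Tuple.monotone_sort _
  have := hmono hle
  simp only [Equiv.trans_apply, Function.comp_apply, Equiv.apply_symm_apply,
    Equiv.symm_apply_apply] at this
  omega

variable {c : α → ℝ}

theorem eq_one_of_pos
    (h : ∀ f : Numbering α, ∃ k, 0 < k ∧ prefixSum c f k = 1 ∧ ∀ j < k, prefixSum c f j ≤ 0)
    {x : α} (hx : 0 < c x) : c x = 1 := by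
  classical
  obtain ⟨f, hf⟩ := exists_lt_of_lt fun y ↦ if y = x then 0 else 1
  have hfx : (f x : ℕ) = 0 := by
    by_contra hne
    let y := f.symm ⟨0, (Nat.zero_le _).trans_lt (f x).2⟩
    have hy : (f y : ℕ) = 0 := by simp [y]
    have hyx : y ≠ x := fun heq ↦ hne (heq ▸ hy)
    have := hf x y (by simp [hyx])
    rw [Fin.lt_def] at this
    omega
  have h1 : prefixSum c f 1 = c x := by
    rw [prefixSum_succ, prefixSum_zero, zero_add, ← hfx, step_apply]
  obtain ⟨k, hk0, hk, hle⟩ := h f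
  rcases (show 1 ≤ k from hk0).eq_or_lt with rfl | hlt
  · exact h1.symm.trans hk
  · linarith [hle 1 hlt]

theorem one_le_sum
    (h : ∀ f : Numbering α, ∃ k, 0 < k ∧ prefixSum c f k = 1 ∧ ∀ j < k, prefixSum c f j ≤ 0) :
    1 ≤ ∑ x, c x := by
  classical
  obtain ⟨f, hf⟩ := exists_lt_of_lt fun y ↦ if c y ≤ 0 then 0 else 1
  obtain ⟨k, hk0, hk, hle⟩ := h f
  rw [← Finset.sum_filter_add_sum_filter_not Finset.univ fun x ↦ (f x : ℕ) < k]
  rw [prefixSum] at hk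
  rw [hk, le_add_iff_nonneg_right]
  obtain ⟨y, hyk, hy⟩ : ∃ y, (f y : ℕ) < k ∧ 0 < c y := by
    by_contra! hne
    have : ∑ x with (f x : ℕ) < k, c x ≤ 0 :=
      Finset.sum_nonpos fun x hx ↦ hne x (by simpa using hx)
    linarith
  refine Finset.sum_nonneg fun x hx ↦ ?_
  by_contra! hneg
  have := hf x y (by simp [hneg.le, hy.not_ge])
  rw [Fin.lt_def] at this
  simp only [Finset.mem_filter, Finset.mem_univ, true_and] at hx
  omega

theorem exists_intCast_of_nonpos
    (h : ∀ f : Numbering α, ∃ k, 0 < k ∧ prefixSum c f k = 1 ∧ ∀ j < k, prefixSum c f j ≤ 0)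
    {x : α} (hx : c x ≤ 0) : ∃ m : ℤ, c x = m := by
  classical
  obtain ⟨f, hf⟩ := exists_lt_of_lt fun y ↦ if y = x then 0 else if 0 < c y then 1 else 2
  obtain ⟨k, hk0, hk, hle⟩ := h f
  have hxk : (f x : ℕ) < k := by
    by_contra! hne
    let y := f.symm ⟨0, (Nat.zero_le _).trans_lt (f x).2⟩
    have hy : (f y : ℕ) = 0 := by simp [y]
    have hyx : y ≠ x := fun heq ↦ by
      rw [heq] at hy
      omega
    have := hf x y (by simp only [if_true, if_neg hyx]; split_ifs <;> norm_num)
    rw [Fin.lt_def] at this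
    omega
  have hones : ∀ y, y ≠ x → (f y : ℕ) < k → 0 < c y := by
    intro y₀ hy₀ hyk₀
    by_contra hc₀
    obtain ⟨y, hymem, hymin⟩ := Finset.exists_min_image
      (Finset.univ.filter fun y ↦ y ≠ x ∧ ¬ 0 < c y) f ⟨y₀, by simp [hy₀] at hc₀ ⊢; exact hc₀⟩
    simp only [Finset.mem_filter, Finset.mem_univ, true_and] at hymem hymin
    have hyk : (f y : ℕ) < k := lt_of_le_of_lt (hymin y₀ ⟨hy₀, hc₀⟩) hyk₀
    have hnonpos := hle (f y) hyk
    have hsum := one_le_sum h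
    rw [← Finset.sum_filter_add_sum_filter_not Finset.univ fun x ↦ (f x : ℕ) < f y] at hsum
    rw [prefixSum] at hnonpos
    have hrest : ∑ z with ¬ (f z : ℕ) < f y, c z ≤ 0 := by
      refine Finset.sum_nonpos fun z hz ↦ ?_
      simp only [Finset.mem_filter, Finset.mem_univ, true_and] at hz
      by_contra! hpos
      have hzx : z ≠ x := fun heq ↦ hpos.not_ge (heq ▸ hx)
      exact hz (hf z y (by simp [hzx, hpos, hymem.1, hymem.2]))
    linarith
  rw [prefixSum, ← Finset.add_sum_erase _ _ (show x ∈ _ by simpa using hxk),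
    Finset.sum_congr rfl (g := fun _ ↦ (1 : ℝ))] at hk
  · refine ⟨1 - (((Finset.univ.filter fun y ↦ (f y : ℕ) < k).erase x).card : ℤ), ?_⟩
    rw [Finset.sum_const, nsmul_eq_mul, mul_one] at hk
    push_cast
    linarith
  · intro y hy
    simp only [Finset.mem_erase, Finset.mem_filter, Finset.mem_univ, true_and] at hy
    exact eq_one_of_pos h (hones y hy.1 hy.2)

open scoped Classical in
theorem sum_weight_eq_one_iff_exists_intCast (c : α → ℝ) :
    ∑ S : Finset α, (if S.Nonempty ∧ ∑ x ∈ S, c x = 1 then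
        1 / ((S.card : ℝ) * (Fintype.card α).choose S.card) else 0) = 1 ↔
      ∃ z : α → ℤ, ((∀ x, z x ≤ 1) ∧ 1 ≤ ∑ x, z x) ∧ (fun x ↦ (z x : ℝ)) = c := by
  rw [sum_weight_eq_one_iff]
  constructor
  · intro h
    have h' : ∀ f : Numbering α, ∃ k, 0 < k ∧ prefixSum c f k = 1 ∧
        ∀ j < k, prefixSum c f j ≤ 0 := by
      intro f
      obtain ⟨⟨k, hk0, hk, hpass⟩, hnum⟩ := h f
      exact ⟨k, hk0, hpass.1, fun j hj ↦ hpass.nonpos hk (hnum k hk0 hk hpass.1) hj⟩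
    have hint : ∀ x, ∃ m : ℤ, c x = m := by
      intro x
      rcases le_or_gt (c x) 0 with hx | hx
      · exact exists_intCast_of_nonpos h' hx
      · exact ⟨1, by simpa using eq_one_of_pos h' hx⟩
    choose z hz using hint
    refine ⟨z, ⟨fun x ↦ ?_, ?_⟩, funext fun x ↦ (hz x).symm⟩
    · have : c x ≤ 1 := by
        rcases le_or_gt (c x) 0 with hx | hx
        · linarith
        · exact (eq_one_of_pos h' hx).le
      rw [hz x] at this
      exact_mod_cast this
    · have := one_le_sum h'
      simp_rw [hz] at this
      exact_mod_cast this
  · rintro ⟨z, ⟨hle, hsum⟩, rfl⟩ f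
    exact ⟨exists_isFirstPassage_intCast hle hsum f,
      fun k hk0 hk hf ↦ numPassages_intCast hk0 hk hf⟩

end Numbering

theorem Finset.card_piAntidiag_univ_nat {ι : Type*} [Fintype ι] [DecidableEq ι] (n : ℕ) :
    (Finset.piAntidiag (Finset.univ : Finset ι) n).card = (Fintype.card ι).multichoose n := by
  rw [← Finset.map_sym_eq_piAntidiag, Finset.card_map, Finset.sym_univ, Finset.card_univ,
    Sym.card_sym_eq_multichoose]

theorem ncard_le_one_and_one_le_sum (n : ℕ) (hn : 1 ≤ n) :
    {c : Fin n → ℤ | (∀ i, c i ≤ 1) ∧ 1 ≤ ∑ i, c i}.ncard = Nat.choose (2 * n - 1) n := by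
  let s := (Finset.range n).biUnion fun k ↦ Finset.piAntidiag (Finset.univ : Finset (Fin n)) k
  have hinj : Function.Injective fun (y : Fin n → ℕ) (i : Fin n) ↦ (1 : ℤ) - y i := by
    intro y y' h
    funext i
    have := congrFun h i
    simp only at this
    omega
  have himage : {c : Fin n → ℤ | (∀ i, c i ≤ 1) ∧ 1 ≤ ∑ i, c i} =
      (fun (y : Fin n → ℕ) (i : Fin n) ↦ (1 : ℤ) - y i) '' (s : Set (Fin n → ℕ)) := by
    ext c
    simp only [Set.mem_ofPred_eq, Set.mem_image, Finset.mem_coe, s, Finset.mem_biUnion,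
      Finset.mem_range, Finset.mem_piAntidiag, Finset.mem_univ, implies_true, and_true,
      exists_eq_right']
    constructor
    · rintro ⟨hle, hsum⟩
      have hc : ∀ i, (1 : ℤ) - ((1 - c i).toNat : ℕ) = c i := fun i ↦ by
        have := hle i
        omega
      refine ⟨fun i ↦ (1 - c i).toNat, ?_, funext hc⟩
      rw [← Finset.sum_congr rfl fun i _ ↦ hc i, Finset.sum_sub_distrib, ← Nat.cast_sum] at hsum
      simp only [Finset.sum_const, Finset.card_univ, Fintype.card_fin, nsmul_eq_mul,
        mul_one] at hsum
      omega
    · rintro ⟨y, hy, rfl⟩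
      refine ⟨fun i ↦ sub_le_self _ (Int.natCast_nonneg _), ?_⟩
      rw [Finset.sum_sub_distrib, ← Nat.cast_sum]
      simp only [Finset.sum_const, Finset.card_univ, Fintype.card_fin, nsmul_eq_mul, mul_one]
      change Finset.univ.sum y < n at hy
      have : Finset.univ.sum y = ∑ i, y i := rfl
      omega
  have hdisj : (Finset.range n : Set ℕ).PairwiseDisjoint fun k ↦
      Finset.piAntidiag (Finset.univ : Finset (Fin n)) k := by
    intro k _ l _ hkl
    refine Finset.disjoint_left.2 fun y hk hl ↦ hkl ?_
    rw [Finset.mem_piAntidiag] at hk hl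
    exact hk.1.symm.trans hl.1
  rw [himage, Set.ncard_image_of_injective _ hinj, Set.ncard_coe_finset,
    Finset.card_biUnion hdisj]
  simp_rw [Finset.card_piAntidiag_univ_nat, Fintype.card_fin]
  obtain ⟨m, rfl⟩ : ∃ m, n = m + 1 := ⟨n - 1, by omega⟩
  rw [Nat.sum_range_multichoose]
  congr 1
  omega

theorem count_weight_one_hyperplanes (n : ℕ) (hn : 1 ≤ n) :
    {c : Fin n → ℤ | (∀ i, c i ≤ 1) ∧ 1 ≤ ∑ i, c i}.ncard = Nat.choose (2 * n - 1) n ∧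
    {c : Fin n → ℝ | hyperplaneWeight c = 1}.ncard = Nat.choose (2 * n - 1) n := by
  refine ⟨ncard_le_one_and_one_le_sum n hn, ?_⟩
  have himage : {c : Fin n → ℝ | hyperplaneWeight c = 1} =
      (fun (z : Fin n → ℤ) (i : Fin n) ↦ (z i : ℝ)) ''
        {c : Fin n → ℤ | (∀ i, c i ≤ 1) ∧ 1 ≤ ∑ i, c i} := by
    ext c
    have h := Numbering.sum_weight_eq_one_iff_exists_intCast c
    rw [Fintype.card_fin] at h
    exact h
  rw [himage, Set.ncard_image_of_injective, ncard_le_one_and_one_le_sum n hn]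
  intro z z' h
  funext i
  exact Int.cast_injective (congrFun h i)
end

section
/- For every integer k ≥ 65 with k mod 20 ∉ {2, 11}, we have f(6, k) = ⌈49k/20⌉. -/
open scoped Classical in
/-- `coverNumber n k` is the minimum size of a multiset `C` of coefficient vectors
`c ∈ ℝ^n` (each representing the hyperplane `{x : ∑ i, c i * x i = 1}`, which avoids
the origin) such that every nonzero point `x ∈ {0,1}^n` lies on at least `k` of the
hyperplanes, counted with multiplicity. -/
noncomputable def coverNumber (n k : ℕ) : ℕ :=
  sInf {m | ∃ C : Multiset (Fin n → ℝ),
    Multiset.card C = m ∧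
    ∀ x : Fin n → ℝ, (∀ i, x i = 0 ∨ x i = 1) → x ≠ 0 →
      k ≤ Multiset.card (C.filter (fun c => ∑ i, c i * x i = 1))}

/-- The `n`-th harmonic number, as a real number. -/
noncomputable def harmonicR (n : ℕ) : ℝ := ∑ i ∈ Finset.range n, 1 / ((i : ℝ) + 1)

/-- The sum of the first `t` entries of `a`. -/
def prefixSum {n : ℕ} (a : Fin n → ℝ) (t : ℕ) : ℝ :=
  ∑ i ∈ Finset.range t, if h : i < n then a ⟨i, h⟩ else 0

/-- **Cycle lemma.** If `f 0 + ⋯ + f (j - 1) = 1`, then some cyclic rotation has all its proper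
nonempty prefix sums below `1`. -/
lemma exists_rotation_sum_lt_one (f : ℕ → ℝ) {j : ℕ} (hj : 0 < j)
    (hf : ∑ i ∈ Finset.range j, f i = 1) :
    ∃ r < j, ∑ i ∈ Finset.range j, f ((i + r) % j) = 1 ∧ ∀ t, 0 < t → t < j → ∑ i ∈ Finset.range t, f ((i + r) % j) < 1 := by
  set P : ℕ → ℝ := fun s ↦ ∑ i ∈ Finset.range s, f (i % j) with hP
  have hsplit (s t : ℕ) : P (s + t) = P s + ∑ i ∈ Finset.range t, f ((i + s) % j) := by
    simp only [hP, Finset.sum_range_add, add_comm]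
  have hperiod (s : ℕ) : P (j + s) = 1 + P s := by
    rw [hsplit, ← hf]
    congr 1
    · exact Finset.sum_congr rfl fun i hi ↦ by rw [Nat.mod_eq_of_lt (Finset.mem_range.1 hi)]
    · simp [hP]
  have hex : ∃ r, r < j ∧ ∀ s < j, P s ≤ P r := by
    obtain ⟨r, hr, hmax⟩ := Finset.exists_max_image (Finset.range j) P ⟨0, by simpa⟩
    exact ⟨r, by simpa using hr, fun s hs ↦ hmax s (by simpa using hs)⟩
  classical
  obtain ⟨hr, hmax⟩ := Nat.find_spec hex
  set r := Nat.find hex with hrdef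
  have hfirst (s : ℕ) (hs : s < r) : P s < P r := by
    by_contra! h
    exact Nat.find_min hex hs ⟨hs.trans hr, fun u hu ↦ (hmax u hu).trans h⟩
  refine ⟨r, hr, by linarith [hsplit r j, hperiod r, congrArg P (add_comm r j)],
    fun t ht0 htj ↦ ?_⟩
  have h1 := hsplit r t
  rcases lt_or_ge (r + t) j with h | h
  · linarith [hmax _ h]
  · obtain ⟨s, hs⟩ := Nat.exists_eq_add_of_le h
    have h2 := hperiod s
    rw [← hs] at h2
    linarith [hfirst s (by omega)]

lemma coe_cycleRange_pow_apply {n : ℕ} (m i : Fin n) (hi : i ≤ m) (r : ℕ) :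
    (((Fin.cycleRange m) ^ r) i : ℕ) = (i + r) % (m + 1) := by
  induction r with
  | zero => simpa using (Nat.mod_eq_of_lt (Nat.lt_succ_of_le hi)).symm
  | succ r ih =>
    have hle : ((Fin.cycleRange m) ^ r) i ≤ m := by
      rw [Fin.le_def, ih]
      exact Nat.lt_succ_iff.1 (Nat.mod_lt _ (Nat.succ_pos _))
    have hlt := Nat.mod_lt ((i : ℕ) + r) (Nat.succ_pos m)
    rw [pow_succ', Equiv.Perm.mul_apply, Fin.coe_cycleRange_of_le hle, ← add_assoc, Nat.add_mod,
      ← ih]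
    rw [← ih] at hlt
    by_cases h : ((Fin.cycleRange m) ^ r) i = m
    · rw [if_pos h, h, Nat.add_mod_mod, Nat.mod_self]
    · rw [if_neg h, Nat.add_mod_mod, Nat.mod_eq_of_lt]
      have := Fin.val_ne_of_ne h
      omega

/-- `a` reaches the value `1` as its `j`-th prefix sum, all earlier ones being below `1`. -/
def FirstReachesOne {n : ℕ} (a : Fin n → ℝ) (j : ℕ) : Prop :=
  prefixSum a j = 1 ∧ ∀ t, 0 < t → t < j → prefixSum a t < 1

lemma FirstReachesOne.unique {n : ℕ} {a : Fin n → ℝ} {i j : ℕ} (hi : 0 < i) (hj : 0 < j)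
    (h : FirstReachesOne a i) (h' : FirstReachesOne a j) : i = j := by
  by_contra hne
  rcases Nat.lt_or_gt_of_ne hne with hlt | hlt
  · exact absurd h.1 (h'.2 i hi hlt).ne
  · exact absurd h'.1 (h.2 j hj hlt).ne

lemma prefixSum_comp_cycleRange_pow {n : ℕ} (a : Fin n → ℝ) (m : Fin n) (r : ℕ) {t : ℕ}
    (ht : t ≤ m + 1) :
    prefixSum (a ∘ ((Fin.cycleRange m) ^ r : Equiv.Perm (Fin n))) t =
      ∑ i ∈ Finset.range t,
        (fun i ↦ if h : i < n then a ⟨i, h⟩ else 0) ((i + r) % (m + 1)) := by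
  refine Finset.sum_congr rfl fun i hi ↦ ?_
  have him : i < (m : ℕ) + 1 := (Finset.mem_range.1 hi).trans_le ht
  have hmod : (i + r) % ((m : ℕ) + 1) < n :=
    (Nat.lt_succ_iff.1 (Nat.mod_lt _ (Nat.succ_pos _))).trans_lt m.2
  have hin : i < n := (Nat.lt_succ_iff.1 him).trans_lt m.2
  simp only [dif_pos hmod, dif_pos hin, Function.comp_apply]
  congr 1
  exact Fin.ext (coe_cycleRange_pow_apply m ⟨i, hin⟩ (Nat.lt_succ_iff.1 him) r)

lemma exists_firstReachesOne_rotation {n : ℕ} (a : Fin n → ℝ) (m : Fin n)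
    (ha : prefixSum a (m + 1) = 1) :
    ∃ r < (m : ℕ) + 1,
      FirstReachesOne (a ∘ ((Fin.cycleRange m) ^ r : Equiv.Perm (Fin n))) (m + 1) := by
  obtain ⟨r, hr, hone, h⟩ := exists_rotation_sum_lt_one _ (Nat.succ_pos (m : ℕ)) ha
  refine ⟨r, hr, ?_, fun t ht0 ht ↦ ?_⟩
  · rwa [prefixSum_comp_cycleRange_pow a m r le_rfl]
  · rw [prefixSum_comp_cycleRange_pow a m r ht.le]
    exact h t ht0 ht

open scoped Classical in
lemma card_prefixSum_eq_one_le {n : ℕ} (c : Fin n → ℝ) (m : Fin n) :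
    (Finset.univ.filter fun σ : Equiv.Perm (Fin n) ↦ prefixSum (c ∘ σ) (m + 1) = 1).card ≤
      (m + 1) * (Finset.univ.filter fun σ : Equiv.Perm (Fin n) ↦
        FirstReachesOne (c ∘ σ) (m + 1)).card := by
  set ρ := Fin.cycleRange m
  have hsub : (Finset.univ.filter fun σ : Equiv.Perm (Fin n) ↦ prefixSum (c ∘ σ) (m + 1) = 1) ⊆
      (Finset.range (m + 1)).biUnion fun r ↦ Finset.univ.filter fun σ : Equiv.Perm (Fin n) ↦
        FirstReachesOne (c ∘ (σ * ρ ^ r : Equiv.Perm (Fin n))) (m + 1) := by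
    intro σ hσ
    obtain ⟨r, hr, h⟩ := exists_firstReachesOne_rotation (c ∘ σ) m (Finset.mem_filter.1 hσ).2
    exact Finset.mem_biUnion.2 ⟨r, Finset.mem_range.2 hr,
      Finset.mem_filter.2 ⟨Finset.mem_univ _, h⟩⟩
  refine (Finset.card_le_card hsub).trans (Finset.card_biUnion_le.trans ?_)
  rw [← smul_eq_mul]
  refine (Finset.sum_le_card_nsmul _ _ _ fun r _ ↦ le_of_eq ?_).trans_eq
    (by rw [Finset.card_range])
  exact Finset.card_equiv (Equiv.mulRight (ρ ^ r)) fun σ ↦ by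
    simp only [Finset.mem_filter, Finset.mem_univ, true_and, Equiv.coe_mulRight]

open scoped Classical in
lemma sum_card_prefixSum_eq_one_div_le {n : ℕ} (c : Fin n → ℝ) :
    ∑ m : Fin n, ((Finset.univ.filter fun σ : Equiv.Perm (Fin n) ↦
      prefixSum (c ∘ σ) (m + 1) = 1).card : ℝ) / ((m : ℝ) + 1) ≤ n.factorial := by
  calc _ ≤ ∑ m : Fin n, ((Finset.univ.filter fun σ : Equiv.Perm (Fin n) ↦
      FirstReachesOne (c ∘ σ) (m + 1)).card : ℝ) := by
        refine Finset.sum_le_sum fun m _ ↦ ?_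
        rw [div_le_iff₀' (by positivity)]
        exact_mod_cast card_prefixSum_eq_one_le c m
    _ ≤ n.factorial := by
        rw [← Nat.cast_sum, ← Finset.card_biUnion]
        · have h := Finset.card_le_univ (Finset.univ.biUnion fun m : Fin n ↦
            Finset.univ.filter fun σ : Equiv.Perm (Fin n) ↦ FirstReachesOne (c ∘ σ) (m + 1))
          rw [Fintype.card_perm, Fintype.card_fin] at h
          exact_mod_cast h
        · intro i _ j _ hij
          refine Finset.disjoint_filter.2 fun σ _ hi hj ↦ hij (Fin.ext ?_)
          simpa using hi.unique (Nat.succ_pos _) (Nat.succ_pos _) hj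

/-- The point of the cube whose support is the image under `σ` of the first `t` indices. -/
def prefixPoint {n : ℕ} (σ : Equiv.Perm (Fin n)) (t : ℕ) : Fin n → ℝ :=
  fun i ↦ if (σ.symm i : ℕ) < t then 1 else 0

lemma sum_mul_prefixPoint {n : ℕ} (c : Fin n → ℝ) (σ : Equiv.Perm (Fin n)) {t : ℕ} (ht : t ≤ n) :
    ∑ i, c i * prefixPoint σ t i = prefixSum (c ∘ σ) t := by
  rw [← Equiv.sum_comp σ]
  simp only [prefixPoint, Equiv.symm_apply_apply, mul_ite, mul_one, mul_zero]
  rw [Finset.sum_fin_eq_sum_range, prefixSum]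
  refine (Finset.sum_subset_zero_on_sdiff (Finset.range_mono ht) ?_ ?_).symm
  · intro i hi
    simp at hi
    simp [hi.1, hi.2]
  · intro i hi
    simp at hi
    simp [hi]

lemma Multiset.sum_map_boole {α : Type*} (s : Multiset α) (p : α → Prop) [DecidablePred p] :
    (s.map fun a ↦ if p a then (1 : ℝ) else 0).sum = Multiset.card (s.filter p) := by
  induction s using Multiset.induction with
  | empty => simp
  | cons a s ih =>
    by_cases h : p a
    · simp [h, ih, add_comm]
    · simp [h, ih]

/-- `C` is an almost `k`-cover of the cube `{0,1}^n`. -/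
def IsAlmostCover {n : ℕ} (k : ℕ) (C : Multiset (Fin n → ℝ)) : Prop :=
  open scoped Classical in
  ∀ x : Fin n → ℝ, (∀ i, x i = 0 ∨ x i = 1) → x ≠ 0 →
    k ≤ Multiset.card (C.filter (fun c => ∑ i, c i * x i = 1))

/-- An almost `k`-cover of `{0,1}^n` has at least `k (1 + 1/2 + ⋯ + 1/n)` members. -/
theorem IsAlmostCover.mul_sum_inv_le_card {n k : ℕ} {C : Multiset (Fin n → ℝ)}
    (hC : IsAlmostCover k C) :
    (k : ℝ) * ∑ m : Fin n, 1 / ((m : ℝ) + 1) ≤ Multiset.card C := by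
  classical
  have hpoint (σ : Equiv.Perm (Fin n)) (m : Fin n) :
      (k : ℝ) ≤ (C.map fun c ↦ if prefixSum (c ∘ σ) (m + 1) = 1 then (1 : ℝ) else 0).sum := by
    have h := hC (prefixPoint σ (m + 1)) (fun i ↦ by unfold prefixPoint; split_ifs <;> simp)
      (fun h ↦ by simpa [prefixPoint] using congrFun h (σ m))
    simp only [sum_mul_prefixPoint _ σ (Nat.succ_le_of_lt m.2)] at h
    rw [Multiset.sum_map_boole]
    exact_mod_cast h
  have hupper : (C.map fun c ↦ ∑ m : Fin n, ∑ σ : Equiv.Perm (Fin n),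
      (if prefixSum (c ∘ σ) (m + 1) = 1 then (1 : ℝ) else 0) / ((m : ℝ) + 1)).sum ≤
      Multiset.card C * n.factorial := by
    rw [← nsmul_eq_mul]
    refine (Multiset.sum_le_card_nsmul _ (n.factorial : ℝ) ?_).trans_eq
      (by rw [Multiset.card_map])
    intro y hy
    obtain ⟨c, -, rfl⟩ := Multiset.mem_map.1 hy
    refine le_trans (le_of_eq (Finset.sum_congr rfl fun m _ ↦ ?_))
      (sum_card_prefixSum_eq_one_div_le c)
    rw [← Finset.sum_div, Finset.sum_boole]
  have hlower : (k : ℝ) * (∑ m : Fin n, 1 / ((m : ℝ) + 1)) * n.factorial ≤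
      (C.map fun c ↦ ∑ m : Fin n, ∑ σ : Equiv.Perm (Fin n),
      (if prefixSum (c ∘ σ) (m + 1) = 1 then (1 : ℝ) else 0) / ((m : ℝ) + 1)).sum := by
    rw [Multiset.sum_map_sum]
    simp only [Multiset.sum_map_sum, Multiset.sum_map_div]
    rw [Finset.mul_sum, Finset.sum_mul]
    refine Finset.sum_le_sum fun m _ ↦ ?_
    calc (k : ℝ) * (1 / ((m : ℝ) + 1)) * n.factorial
        = ∑ σ : Equiv.Perm (Fin n), (k : ℝ) / ((m : ℝ) + 1) := by
          rw [Finset.sum_const, Finset.card_univ, Fintype.card_perm, Fintype.card_fin,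
            nsmul_eq_mul]
          ring
      _ ≤ _ := Finset.sum_le_sum fun σ _ ↦ by gcongr; exact hpoint σ m
  exact le_of_mul_le_mul_right (hlower.trans hupper) (by positivity)

/-- A list of triples `(m, d, v)`, standing for `m` copies of each of the first `d` rotations
of `v`. -/
abbrev RotationData := List (ℕ × ℕ × (Fin 6 → ℤ))

/-- Rotate the first four coordinates of a vector. -/
def rotateFour (v : Fin 6 → ℤ) : Fin 6 → ℤ := ![v 1, v 2, v 3, v 0, v 4, v 5]

/-- The integer vectors described by rotation data. -/
def RotationData.vectors (D : RotationData) : List (Fin 6 → ℤ) :=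
  D.flatMap fun e ↦ (List.range e.2.1).flatMap fun r ↦ List.replicate e.1 (rotateFour^[r] e.2.2)

/-- The sum of the coordinates of `v` selected by `b₀, …, b₅`. -/
def selectedSum (v : Fin 6 → ℤ) (b₀ b₁ b₂ b₃ b₄ b₅ : Bool) : ℤ :=
  cond b₀ (v 0) 0 + cond b₁ (v 1) 0 + cond b₂ (v 2) 0 + cond b₃ (v 3) 0 + cond b₄ (v 4) 0 +
    cond b₅ (v 5) 0

/-- A decidable form of being an almost `k`-cover of `{0,1}^6`, for integer vectors. -/
def CoversSelections (k : ℕ) (L : List (Fin 6 → ℤ)) : Prop :=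
  ∀ b₀ b₁ b₂ b₃ b₄ b₅ : Bool, (b₀ || b₁ || b₂ || b₃ || b₄ || b₅) = true →
    k ≤ L.countP fun v ↦ selectedSum v b₀ b₁ b₂ b₃ b₄ b₅ = 1

instance (k : ℕ) (L : List (Fin 6 → ℤ)) : Decidable (CoversSelections k L) := by
  unfold CoversSelections; infer_instance

/-- The cube `{0,1}^n` has an almost `k`-cover of size `m`. -/
def HasAlmostCover (n k m : ℕ) : Prop :=
  ∃ C : Multiset (Fin n → ℝ), Multiset.card C = m ∧ IsAlmostCover k C

lemma HasAlmostCover.add {n k k' m m' : ℕ} (h : HasAlmostCover n k m)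
    (h' : HasAlmostCover n k' m') : HasAlmostCover n (k + k') (m + m') := by
  obtain ⟨C, rfl, hC⟩ := h
  obtain ⟨C', rfl, hC'⟩ := h'
  refine ⟨C + C', Multiset.card_add _ _, fun x hx hx0 ↦ ?_⟩
  rw [Multiset.filter_add, Multiset.card_add]
  exact add_le_add (hC x hx hx0) (hC' x hx hx0)

lemma HasAlmostCover.nsmul {n k m : ℕ} (h : HasAlmostCover n k m) (q : ℕ) :
    HasAlmostCover n (q * k) (q * m) := by
  induction q with
  | zero => exact ⟨0, by simp, fun x _ _ ↦ by simp⟩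
  | succ q ih => simpa only [Nat.succ_mul] using ih.add h

lemma CoversSelections.hasAlmostCover {k : ℕ} {L : List (Fin 6 → ℤ)}
    (h : CoversSelections k L) : HasAlmostCover 6 k L.length := by
  classical
  refine ⟨(L.map fun v i ↦ (v i : ℝ) : List (Fin 6 → ℝ)), by simp, fun x hx hx0 ↦ ?_⟩
  have hb : (decide (x 0 = 1) || decide (x 1 = 1) || decide (x 2 = 1) || decide (x 3 = 1) ||
      decide (x 4 = 1) || decide (x 5 = 1)) = true := by
    by_contra hne
    simp only [Bool.or_eq_true, decide_eq_true_eq, not_or] at hne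
    refine hx0 (funext fun i ↦ (hx i).resolve_right ?_)
    fin_cases i <;> simp [hne]
  have hsum (v : Fin 6 → ℤ) : ∑ i, (v i : ℝ) * x i =
      (selectedSum v (x 0 = 1) (x 1 = 1) (x 2 = 1) (x 3 = 1) (x 4 = 1) (x 5 = 1) : ℤ) := by
    have hterm (i : Fin 6) : (v i : ℝ) * x i = (cond (decide (x i = 1)) (v i) 0 : ℤ) := by
      rcases hx i with h | h <;> simp [h]
    simp only [Fin.sum_univ_six, hterm, selectedSum, Int.cast_add]
  refine (h _ _ _ _ _ _ hb).trans_eq ?_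
  rw [← Multiset.countP_eq_card_filter, Multiset.coe_countP, List.countP_map]
  refine List.countP_congr fun v _ ↦ ?_
  simp only [Function.comp_apply, hsum, decide_eq_true_eq, Int.cast_eq_one]

lemma RotationData.hasAlmostCover {k m : ℕ} (D : RotationData)
    (h : CoversSelections k D.vectors ∧ D.vectors.length = m) : HasAlmostCover 6 k m :=
  h.2 ▸ h.1.hasAlmostCover

/-- An almost `20`-cover of `{0,1}^6` by `49` hyperplanes. -/
def coverTwenty : RotationData :=
  [(1, 4, ![-2, 1, 1, 0, 1, 0]), (1, 4, ![-1, 1, 1, 0, -1, 1]), (2, 1, ![0, 0, 0, 0, 0, 1]),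
   (2, 1, ![0, 0, 0, 0, 1, 0]), (2, 1, ![0, 0, 0, 0, 1, 1]), (1, 4, ![0, 0, 0, 1, 0, 0]),
   (2, 4, ![0, 0, 0, 1, 0, 1]), (1, 4, ![0, 0, 0, 1, 1, 0]), (1, 4, ![0, 0, 1, 1, 0, -1]),
   (1, 4, ![0, 0, 1, 1, 1, -1]), (1, 2, ![0, 1, 0, 1, 0, 0]), (2, 2, ![0, 1, 0, 1, 1, 1]),
   (1, 1, ![1, 1, 1, 1, -2, 0]), (1, 1, ![1, 1, 1, 1, -1, -1]), (1, 1, ![1, 1, 1, 1, -1, 0]),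
   (1, 1, ![1, 1, 1, 1, 0, -2]), (1, 1, ![1, 1, 1, 1, 0, -1])]

/-- An almost `24`-cover of `{0,1}^6` by `59` hyperplanes. -/
def coverTwentyFour : RotationData :=
  [(1, 4, ![-1, 0, 0, 1, 1, 0]), (1, 4, ![-1, 1, 0, 0, 0, 1]), (1, 4, ![-1, 1, 0, 0, 1, 1]),
   (1, 4, ![-1, 1, 0, 1, 1, 0]), (1, 4, ![-1, 1, 1, 0, 0, 1]), (2, 1, ![0, 0, 0, 0, 0, 1]),
   (1, 1, ![0, 0, 0, 0, 1, 1]), (1, 4, ![0, 0, 0, 1, 0, 0]), (1, 4, ![0, 0, 0, 1, 0, 1]),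
   (1, 4, ![0, 0, 0, 1, 1, -1]), (1, 4, ![0, 0, 0, 1, 1, 0]), (2, 4, ![0, 0, 1, 1, 0, 0]),
   (1, 2, ![0, 1, 0, 1, -1, 1]), (1, 2, ![0, 1, 0, 1, 0, 1]), (1, 2, ![0, 1, 0, 1, 1, 0]),
   (1, 1, ![1, 1, 1, 1, -4, 1]), (1, 1, ![1, 1, 1, 1, -3, 0]), (1, 1, ![1, 1, 1, 1, -2, -1]),
   (1, 1, ![1, 1, 1, 1, -1, -2]), (1, 1, ![1, 1, 1, 1, 0, -3]), (1, 1, ![1, 1, 1, 1, 1, -4])]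

/-- An almost `26`-cover of `{0,1}^6` by `64` hyperplanes. -/
def coverTwentySix : RotationData :=
  [(1, 4, ![-1, 0, 0, 1, 0, 1]), (1, 4, ![-1, 0, 0, 1, 1, 1]), (1, 4, ![-1, 0, 1, 1, 0, 1]),
   (1, 4, ![-1, 0, 1, 1, 1, -1]), (1, 4, ![-1, 1, 1, 0, 0, 0]), (1, 1, ![0, 0, 0, 0, 0, 1]),
   (3, 1, ![0, 0, 0, 0, 1, 0]), (1, 1, ![0, 0, 0, 0, 1, 1]), (1, 4, ![0, 0, 0, 1, 0, 0]),
   (1, 4, ![0, 0, 0, 1, 0, 1]), (2, 4, ![0, 0, 0, 1, 1, 0]), (1, 4, ![0, 0, 1, 1, -1, 0]),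
   (1, 4, ![0, 0, 1, 1, 0, 0]), (1, 2, ![0, 1, 0, 1, -2, 1]), (2, 2, ![0, 1, 0, 1, 0, 0]),
   (2, 2, ![0, 1, 0, 1, 1, 1]), (1, 1, ![1, 1, 1, 1, -3, 1]), (1, 1, ![1, 1, 1, 1, -2, 1]),
   (1, 1, ![1, 1, 1, 1, -1, -1]), (2, 1, ![1, 1, 1, 1, 1, 0])]

/-- An almost `35`-cover of `{0,1}^6` by `86` hyperplanes. -/
def coverThirtyFive : RotationData :=
  [(1, 4, ![-1, 0, -1, 1, 1, 1]), (1, 4, ![-1, 0, 0, 1, 1, 1]), (1, 4, ![-1, 0, 1, 1, 1, 0]),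
   (1, 4, ![-1, 1, 0, 0, 1, 0]), (1, 4, ![-1, 1, 1, 0, 0, 0]), (1, 4, ![-1, 1, 1, 0, 0, 1]),
   (2, 1, ![0, 0, 0, 0, 0, 1]), (2, 1, ![0, 0, 0, 0, 1, 0]), (1, 1, ![0, 0, 0, 0, 1, 1]),
   (1, 4, ![0, 0, 0, 1, -1, 1]), (3, 4, ![0, 0, 0, 1, 0, 0]), (1, 4, ![0, 0, 0, 1, 0, 1]),
   (2, 4, ![0, 0, 0, 1, 1, 0]), (2, 4, ![0, 0, 1, 1, 0, 0]), (2, 2, ![0, 1, 0, 1, 0, 0]),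
   (1, 2, ![0, 1, 0, 1, 1, 0]), (2, 2, ![0, 1, 0, 1, 1, 1]), (1, 4, ![0, 1, 1, 1, 0, 1]),
   (2, 1, ![1, 1, 1, 1, -4, 1]), (1, 1, ![1, 1, 1, 1, -2, 0]), (1, 1, ![1, 1, 1, 1, -2, 1]),
   (1, 1, ![1, 1, 1, 1, -1, 1]), (1, 1, ![1, 1, 1, 1, 1, -4]), (1, 1, ![1, 1, 1, 1, 1, 0])]

/-- An almost `37`-cover of `{0,1}^6` by `91` hyperplanes. -/
def coverThirtySeven : RotationData :=
  [(1, 4, ![-1, 0, 1, 1, 0, 0]), (1, 4, ![-1, 1, 0, 0, 0, 1]), (1, 4, ![-1, 1, 0, 0, 1, 0]),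
   (1, 4, ![-1, 1, 1, 0, -1, 1]), (1, 4, ![-1, 1, 1, 0, 0, 1]), (2, 1, ![0, 0, 0, 0, 0, 1]),
   (4, 1, ![0, 0, 0, 0, 1, 0]), (3, 1, ![0, 0, 0, 0, 1, 1]), (3, 4, ![0, 0, 0, 1, 0, 0]),
   (3, 4, ![0, 0, 0, 1, 1, 0]), (1, 4, ![0, 0, 0, 1, 1, 1]), (1, 4, ![0, 0, 1, 1, -1, 1]),
   (1, 4, ![0, 0, 1, 1, 0, 0]), (1, 4, ![0, 0, 1, 1, 0, 1]), (1, 2, ![0, 1, 0, 1, -2, 1]),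
   (1, 2, ![0, 1, 0, 1, -1, 1]), (1, 2, ![0, 1, 0, 1, 0, 0]), (1, 2, ![0, 1, 0, 1, 1, 0]),
   (1, 2, ![0, 1, 0, 1, 1, 1]), (1, 4, ![0, 1, 1, 1, -1, 0]), (1, 1, ![1, 1, 1, 1, -1, -1]),
   (1, 1, ![1, 1, 1, 1, 0, -3]), (1, 1, ![1, 1, 1, 1, 1, -2]), (1, 1, ![1, 1, 1, 1, 1, -1]),
   (2, 1, ![1, 1, 1, 1, 1, 0]), (2, 1, ![1, 1, 1, 1, 1, 1])]

/-- An almost `41`-cover of `{0,1}^6` by `101` hyperplanes. -/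
def coverFortyOne : RotationData :=
  [(2, 4, ![-2, 0, 0, 1, 1, 1]), (1, 4, ![-2, 0, 1, 1, 1, 0]), (1, 4, ![-1, 1, 0, 0, 1, 1]),
   (1, 4, ![-1, 1, 1, 0, -1, 1]), (1, 4, ![-1, 1, 1, 0, 0, 1]), (1, 4, ![-1, 1, 1, 0, 1, 0]),
   (3, 1, ![0, 0, 0, 0, 0, 1]), (2, 1, ![0, 0, 0, 0, 1, 0]), (2, 1, ![0, 0, 0, 0, 1, 1]),
   (3, 4, ![0, 0, 0, 1, 0, 0]), (2, 4, ![0, 0, 0, 1, 0, 1]), (3, 4, ![0, 0, 0, 1, 1, 0]),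
   (2, 4, ![0, 0, 1, 1, 0, 0]), (1, 4, ![0, 0, 1, 1, 0, 1]), (1, 2, ![0, 1, 0, 1, -1, 0]),
   (1, 2, ![0, 1, 0, 1, -1, 1]), (1, 2, ![0, 1, 0, 1, 0, -1]), (2, 2, ![0, 1, 0, 1, 0, 0]),
   (1, 2, ![0, 1, 0, 1, 1, -1]), (1, 1, ![1, 1, 1, 1, -3, 0]), (1, 1, ![1, 1, 1, 1, -2, 1]),
   (1, 1, ![1, 1, 1, 1, -1, -2]), (1, 1, ![1, 1, 1, 1, -1, 1]), (1, 1, ![1, 1, 1, 1, 0, -2]),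
   (1, 1, ![1, 1, 1, 1, 0, -1]), (1, 1, ![1, 1, 1, 1, 0, 0]), (2, 1, ![1, 1, 1, 1, 1, -4]),
   (1, 1, ![1, 1, 1, 1, 1, 0])]

/-- An almost `43`-cover of `{0,1}^6` by `106` hyperplanes. -/
def coverFortyThree : RotationData :=
  [(1, 4, ![-1, 0, 0, 1, 0, 1]), (1, 4, ![-1, 0, 0, 1, 1, 1]), (1, 4, ![-1, 0, 1, 1, 1, 0]),
   (1, 4, ![-1, 1, 1, 0, -1, 1]), (1, 4, ![-1, 1, 1, 0, 1, 0]), (1, 1, ![0, 0, 0, 0, 0, 1]),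
   (6, 1, ![0, 0, 0, 0, 1, 0]), (5, 1, ![0, 0, 0, 0, 1, 1]), (1, 4, ![0, 0, 0, 1, -1, 1]),
   (3, 4, ![0, 0, 0, 1, 0, 0]), (3, 4, ![0, 0, 0, 1, 0, 1]), (1, 4, ![0, 0, 0, 1, 1, 0]),
   (1, 4, ![0, 0, 1, 1, 0, -1]), (1, 4, ![0, 0, 1, 1, 0, 0]), (1, 4, ![0, 0, 1, 1, 1, -1]),
   (1, 4, ![0, 0, 1, 1, 1, 0]), (1, 2, ![0, 1, 0, 1, -2, 1]), (2, 2, ![0, 1, 0, 1, 0, 0]),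
   (1, 2, ![0, 1, 0, 1, 1, -1]), (1, 2, ![0, 1, 0, 1, 1, 0]), (1, 2, ![0, 1, 0, 1, 1, 1]),
   (1, 4, ![0, 1, 1, 1, -2, 0]), (1, 1, ![1, 1, 1, 1, -4, 1]), (2, 1, ![1, 1, 1, 1, -1, 1]),
   (1, 1, ![1, 1, 1, 1, 0, -2]), (2, 1, ![1, 1, 1, 1, 0, -1]), (2, 1, ![1, 1, 1, 1, 0, 1]),
   (1, 1, ![1, 1, 1, 1, 1, -4]), (1, 1, ![1, 1, 1, 1, 1, -1])]

/-- An almost `73`-cover of `{0,1}^6` by `179` hyperplanes. -/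
def coverSeventyThree : RotationData :=
  [(1, 4, ![-2, 0, 1, 1, 0, 1]), (1, 4, ![-1, 0, -1, 1, 1, 1]), (1, 4, ![-1, 0, 0, 1, 0, 1]),
   (1, 4, ![-1, 0, 0, 1, 1, 1]), (1, 4, ![-1, 0, 1, 1, 0, 0]), (1, 4, ![-1, 1, 1, 0, 0, 0]),
   (1, 4, ![-1, 1, 1, 0, 0, 1]), (2, 4, ![-1, 1, 1, 0, 1, 0]), (1, 4, ![-1, 1, 1, 0, 1, 1]),
   (6, 1, ![0, 0, 0, 0, 0, 1]), (7, 1, ![0, 0, 0, 0, 1, 0]), (5, 1, ![0, 0, 0, 0, 1, 1]),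
   (3, 4, ![0, 0, 0, 1, 0, 0]), (5, 4, ![0, 0, 0, 1, 0, 1]), (1, 4, ![0, 0, 0, 1, 1, -1]),
   (3, 4, ![0, 0, 0, 1, 1, 0]), (1, 4, ![0, 0, 0, 1, 1, 1]), (2, 4, ![0, 0, 1, 1, -1, 0]),
   (1, 4, ![0, 0, 1, 1, 0, -1]), (2, 4, ![0, 0, 1, 1, 0, 0]), (1, 4, ![0, 0, 1, 1, 1, -2]),
   (1, 4, ![0, 0, 1, 1, 1, -1]), (2, 2, ![0, 1, 0, 1, -2, 1]), (1, 2, ![0, 1, 0, 1, -1, 0]),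
   (1, 2, ![0, 1, 0, 1, -1, 1]), (3, 2, ![0, 1, 0, 1, 0, 0]), (2, 2, ![0, 1, 0, 1, 0, 1]),
   (1, 2, ![0, 1, 0, 1, 1, -1]), (2, 2, ![0, 1, 0, 1, 1, 0]), (1, 1, ![1, 1, 1, 1, -3, 1]),
   (1, 1, ![1, 1, 1, 1, -2, 0]), (1, 1, ![1, 1, 1, 1, -1, -1]), (1, 1, ![1, 1, 1, 1, -1, 0]),
   (1, 1, ![1, 1, 1, 1, -1, 1]), (2, 1, ![1, 1, 1, 1, 0, -2]), (2, 1, ![1, 1, 1, 1, 0, -1]),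
   (1, 1, ![1, 1, 1, 1, 0, 0]), (2, 1, ![1, 1, 1, 1, 1, -4]), (2, 1, ![1, 1, 1, 1, 1, -2]),
   (1, 1, ![1, 1, 1, 1, 1, -1]), (2, 1, ![1, 1, 1, 1, 1, 1])]

lemma hasAlmostCover_20 : HasAlmostCover 6 20 49 :=
  coverTwenty.hasAlmostCover (by decide +kernel)

lemma hasAlmostCover_24 : HasAlmostCover 6 24 59 :=
  coverTwentyFour.hasAlmostCover (by decide +kernel)

lemma hasAlmostCover_26 : HasAlmostCover 6 26 64 :=
  coverTwentySix.hasAlmostCover (by decide +kernel)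

lemma hasAlmostCover_35 : HasAlmostCover 6 35 86 :=
  coverThirtyFive.hasAlmostCover (by decide +kernel)

lemma hasAlmostCover_37 : HasAlmostCover 6 37 91 :=
  coverThirtySeven.hasAlmostCover (by decide +kernel)

lemma hasAlmostCover_41 : HasAlmostCover 6 41 101 :=
  coverFortyOne.hasAlmostCover (by decide +kernel)

lemma hasAlmostCover_43 : HasAlmostCover 6 43 106 :=
  coverFortyThree.hasAlmostCover (by decide +kernel)

lemma hasAlmostCover_73 : HasAlmostCover 6 73 179 :=
  coverSeventyThree.hasAlmostCover (by decide +kernel)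

lemma hasAlmostCover_base {s : ℕ} (h65 : 65 ≤ s) (h84 : s ≤ 84) (h71 : s ≠ 71) (h82 : s ≠ 82) :
    ∃ m, HasAlmostCover 6 s m ∧ 20 * m < 49 * s + 20 := by
  interval_cases s
  · exact ⟨_, hasAlmostCover_24.add hasAlmostCover_41, by norm_num⟩
  · exact ⟨_, hasAlmostCover_26.add (hasAlmostCover_20.nsmul 2), by norm_num⟩
  · exact ⟨_, hasAlmostCover_24.add hasAlmostCover_43, by norm_num⟩
  · exact ⟨_, (hasAlmostCover_24.add hasAlmostCover_24).add hasAlmostCover_20, by norm_num⟩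
  · exact ⟨_, hasAlmostCover_26.add hasAlmostCover_43, by norm_num⟩
  · exact ⟨_, hasAlmostCover_35.add hasAlmostCover_35, by norm_num⟩
  · exact absurd rfl h71
  · exact ⟨_, (hasAlmostCover_24.add hasAlmostCover_24).add hasAlmostCover_24, by norm_num⟩
  · exact ⟨_, hasAlmostCover_73, by norm_num⟩
  · exact ⟨_, hasAlmostCover_37.add hasAlmostCover_37, by norm_num⟩
  · exact ⟨_, hasAlmostCover_35.add (hasAlmostCover_20.nsmul 2), by norm_num⟩
  · exact ⟨_, hasAlmostCover_35.add hasAlmostCover_41, by norm_num⟩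
  · exact ⟨_, hasAlmostCover_37.add (hasAlmostCover_20.nsmul 2), by norm_num⟩
  · exact ⟨_, hasAlmostCover_37.add hasAlmostCover_41, by norm_num⟩
  · exact ⟨_, (hasAlmostCover_24.add hasAlmostCover_35).add hasAlmostCover_20, by norm_num⟩
  · exact ⟨_, hasAlmostCover_20.nsmul 4, by norm_num⟩
  · exact ⟨_, hasAlmostCover_41.add (hasAlmostCover_20.nsmul 2), by norm_num⟩
  · exact absurd rfl h82
  · exact ⟨_, hasAlmostCover_43.add (hasAlmostCover_20.nsmul 2), by norm_num⟩
  · exact ⟨_, hasAlmostCover_24.add (hasAlmostCover_20.nsmul 3), by norm_num⟩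

theorem f_six_k (k : ℕ) (hk : 65 ≤ k) (h2 : k % 20 ≠ 2) (h11 : k % 20 ≠ 11) :
    (coverNumber 6 k : ℤ) = ⌈(49 * (k : ℚ)) / 20⌉ := by
  obtain ⟨s, q, rfl, h65, h84⟩ : ∃ s q, k = s + q * 20 ∧ 65 ≤ s ∧ s ≤ 84 :=
    ⟨65 + (k - 65) % 20, (k - 65) / 20, by omega, by omega, by omega⟩
  obtain ⟨m, hm, hlt⟩ := hasAlmostCover_base h65 h84 (by omega) (by omega)
  have hcover := hm.add (hasAlmostCover_20.nsmul q)
  apply le_antisymm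
  · have hle : coverNumber 6 (s + q * 20) ≤ m + q * 49 := Nat.sInf_le hcover
    rw [Int.le_ceil_iff]
    have hle' : (coverNumber 6 (s + q * 20) : ℚ) ≤ m + q * 49 := by exact_mod_cast hle
    have hlt' : (20 * m : ℚ) < 49 * s + 20 := by exact_mod_cast hlt
    push_cast
    linarith
  · obtain ⟨C, hcard, hC⟩ : HasAlmostCover 6 (s + q * 20) (coverNumber 6 (s + q * 20)) :=
      Nat.sInf_mem (s := {m | HasAlmostCover 6 (s + q * 20) m}) ⟨_, hcover⟩
    have hbound := IsAlmostCover.mul_sum_inv_le_card hC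
    have hsum : ∑ i : Fin 6, 1 / ((i : ℝ) + 1) = 49 / 20 := by
      norm_num [Fin.sum_univ_six]
    rw [hsum, hcard, ← mul_div_assoc, div_le_iff₀ (by norm_num)] at hbound
    rw [Int.ceil_le, Int.cast_natCast, div_le_iff₀ (by norm_num), mul_comm (49 : ℚ)]
    exact_mod_cast hbound
end

section
/- Let k ≥ 2 and n ≥ 1 be integers such that 0 < ⌈kH_n⌉ − kH_n < 1/(n·binom(n−1, ⌊n/2⌋)), where H_n = ∑_{i=1}^n 1/i. Then f(n,k) ≥ ⌈kH_n⌉ + 1. -/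
namespace AlmostCover

open Finset Equiv

variable {n : ℕ}

/-! ### Partial sums along an ordering of the coordinates -/

/-- The coefficient of `c` at the `u`-th coordinate in the ordering `σ`, and `0` past the end. -/
def seq (c : Fin n → ℝ) (σ : Perm (Fin n)) (u : ℕ) : ℝ :=
  if h : u < n then c (σ ⟨u, h⟩) else 0

/-- The sum of the coefficients of `c` at the first `i` coordinates in the ordering `σ`. -/
def psum (c : Fin n → ℝ) (σ : Perm (Fin n)) (i : ℕ) : ℝ := ∑ u ∈ range i, seq c σ u

/-- The set of the first `i` coordinates in the ordering `σ`. -/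
def initial (σ : Perm (Fin n)) (i : ℕ) : Finset (Fin n) := {e | (σ.symm e : ℕ) < i}

lemma mem_initial {σ : Perm (Fin n)} {i : ℕ} {e : Fin n} :
    e ∈ initial σ i ↔ (σ.symm e : ℕ) < i := by simp [initial]

lemma psum_eq_sum_initial (c : Fin n → ℝ) (σ : Perm (Fin n)) {i : ℕ} (hi : i ≤ n) :
    psum c σ i = ∑ e ∈ initial σ i, c e := by
  have h1 : ∑ e ∈ initial σ i, c e = ∑ u : Fin n, if (u : ℕ) < i then seq c σ u else 0 := by
    rw [initial, sum_filter, ← Equiv.sum_comp σ]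
    simp [seq]
  have h2 := Finset.sum_range (n := n) (fun u => if u < i then seq c σ u else 0)
  rw [h1, ← h2, ← sum_filter, psum]
  congr 1
  ext u
  simp only [mem_range, mem_filter]
  omega

lemma card_initial (σ : Perm (Fin n)) {i : ℕ} (hi : i ≤ n) : #(initial σ i) = i := by
  have h := psum_eq_sum_initial (fun _ => 1) σ hi
  have h2 : psum (fun _ => 1) σ i = i := by
    rw [psum, sum_congr rfl (g := fun _ => (1 : ℝ))]
    · simp
    · intro u hu
      have : u < n := lt_of_lt_of_le (mem_range.1 hu) hi
      simp [seq, this]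
  rw [h2] at h
  have h3 : (i : ℝ) = #(initial σ i) := by simpa using h
  exact_mod_cast h3.symm

lemma psum_zero (c : Fin n → ℝ) (σ : Perm (Fin n)) : psum c σ 0 = 0 := by simp [psum]

lemma psum_succ (c : Fin n → ℝ) (σ : Perm (Fin n)) (i : ℕ) :
    psum c σ (i + 1) = psum c σ i + seq c σ i := by simp [psum, sum_range_succ]

lemma psum_card (c : Fin n → ℝ) (σ : Perm (Fin n)) : psum c σ n = ∑ e, c e := by
  rw [psum_eq_sum_initial c σ le_rfl]
  congr 1
  ext e
  simp [mem_initial]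

/-! ### Rotations of an initial segment -/

lemma cycleRange_pow_val_of_le (j : Fin n) (r : ℕ) {u : Fin n} (hu : u ≤ j) :
    ((j.cycleRange ^ r) u : ℕ) = (u + r) % (j + 1) := by
  have : NeZero n := ⟨by have := j.2; omega⟩
  induction r with
  | zero =>
    have : (u : ℕ) ≤ j := hu
    rw [Nat.add_zero, Nat.mod_eq_of_lt (by omega)]
    simp
  | succ r ih =>
    rw [pow_succ', Perm.mul_apply]
    set v := (j.cycleRange ^ r) u
    have hlt := Nat.mod_lt (u + r : ℕ) (show 0 < (j : ℕ) + 1 by omega)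
    have hv : v ≤ j := by rw [Fin.le_def]; omega
    rw [← Nat.add_assoc, Nat.add_mod, ← ih]
    rcases hv.lt_or_eq with h | h
    · have h' : (v : ℕ) < j := h
      rw [Fin.cycleRange_of_lt h, Fin.val_add_one_of_lt' (by have := j.2; omega)]
      have h1 : 1 % ((j : ℕ) + 1) = 1 := Nat.mod_eq_of_lt (by omega)
      rw [h1, Nat.mod_eq_of_lt (by omega)]
    · rw [Fin.cycleRange_of_eq h, h]
      simp

lemma cycleRange_pow_of_gt (j : Fin n) (r : ℕ) {u : Fin n} (hu : j < u) :
    (j.cycleRange ^ r) u = u := by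
  induction r with
  | zero => simp
  | succ r ih => rw [pow_succ', Perm.mul_apply, ih, Fin.cycleRange_of_gt hu]

lemma cycleRange_pow_succ_eq_one (j : Fin n) : j.cycleRange ^ ((j : ℕ) + 1) = 1 := by
  ext u
  rcases le_or_gt u j with h | h
  · have h' : (u : ℕ) ≤ j := h
    rw [cycleRange_pow_val_of_le j _ h, Nat.add_mod_right, Nat.mod_eq_of_lt (by omega)]
    simp
  · rw [cycleRange_pow_of_gt j _ h]
    simp

/-- Partial sums of the periodic extension of the first `j + 1` coefficients. -/
def cycSum (c : Fin n → ℝ) (σ : Perm (Fin n)) (j : Fin n) (t : ℕ) : ℝ :=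
  ∑ u ∈ range t, seq c σ (u % (j + 1))

lemma cycSum_of_le (c : Fin n → ℝ) (σ : Perm (Fin n)) (j : Fin n) {t : ℕ} (ht : t ≤ j + 1) :
    cycSum c σ j t = psum c σ t := by
  refine sum_congr rfl fun u hu => ?_
  rw [Nat.mod_eq_of_lt (lt_of_lt_of_le (mem_range.1 hu) ht)]

lemma cycSum_add_period (c : Fin n → ℝ) (σ : Perm (Fin n)) (j : Fin n) (t : ℕ) :
    cycSum c σ j (t + (j + 1)) = cycSum c σ j t + psum c σ (j + 1) := by
  rw [cycSum, Nat.add_comm t, sum_range_add, ← cycSum, cycSum_of_le c σ j le_rfl, cycSum,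
    add_comm]
  simp

lemma psum_mul_cycleRange_pow (c : Fin n → ℝ) (σ : Perm (Fin n)) (j : Fin n) (r : ℕ) {a : ℕ}
    (ha : a ≤ j + 1) :
    psum c (σ * j.cycleRange ^ r) a = cycSum c σ j (r + a) - cycSum c σ j r := by
  rw [cycSum, sum_range_add, ← cycSum, add_sub_cancel_left, psum]
  refine sum_congr rfl fun u hu => ?_
  have hu' := mem_range.1 hu
  have hj := j.2
  have hun : u < n := by omega
  have hlt := Nat.mod_lt (r + u : ℕ) (show 0 < (j : ℕ) + 1 by omega)
  have hlt' : (r + u) % ((j : ℕ) + 1) < n := by omega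
  rw [seq, seq, dif_pos hun, dif_pos hlt', Perm.mul_apply]
  congr 2
  ext
  rw [cycleRange_pow_val_of_le j r (by rw [Fin.le_def]; simp; omega), Nat.add_comm]

lemma psum_mul_cycleRange_pow_succ (c : Fin n → ℝ) (σ : Perm (Fin n)) (j : Fin n) (r : ℕ) :
    psum c (σ * j.cycleRange ^ r) (j + 1) = psum c σ (j + 1) := by
  rw [psum_mul_cycleRange_pow c σ j r le_rfl, cycSum_add_period]
  ring

lemma initial_mul_cycleRange_pow (σ : Perm (Fin n)) (j : Fin n) (r : ℕ) :
    initial (σ * j.cycleRange ^ r) (j + 1) = initial σ (j + 1) := by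
  ext e
  rw [mem_initial, mem_initial]
  obtain ⟨u, rfl⟩ := (σ * j.cycleRange ^ r).surjective e
  rw [symm_apply_apply, Perm.mul_apply, symm_apply_apply]
  rcases le_or_gt u j with h | h
  · rw [cycleRange_pow_val_of_le j _ h]
    have h' : (u : ℕ) ≤ j := h
    have hlt := Nat.mod_lt (u + r : ℕ) (show 0 < (j : ℕ) + 1 by omega)
    omega
  · rw [cycleRange_pow_of_gt j _ h]

/-- A form of the cycle lemma: start right after the first maximum. -/
lemma exists_shift_le_zero_or_lt {B : ℕ → ℝ} {p : ℕ} (hp : 0 < p) {τ : ℝ}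
    (hB : ∀ t, B (t + p) = B t + τ) :
    ∃ r, ∀ a, a < p → B (r + a) - B r ≤ 0 ∨ B (r + a) - B r < τ := by
  classical
  obtain ⟨q, hq, hmax⟩ := exists_max_image (range p) B ⟨0, mem_range.2 hp⟩
  have hex : ∃ t, t < p ∧ B t = B q := ⟨q, mem_range.1 hq, rfl⟩
  obtain ⟨hr, hrq⟩ := Nat.find_spec hex
  refine ⟨Nat.find hex, fun a ha => ?_⟩
  have hmin := fun m (hm : m < Nat.find hex) => Nat.find_min hex hm
  generalize Nat.find hex = r at *
  rcases lt_or_ge (r + a) p with h | h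
  · left
    have := hmax (r + a) (mem_range.2 h)
    linarith
  · right
    obtain ⟨b, hb⟩ := Nat.exists_eq_add_of_le h
    have hbr : b < r := by omega
    have h1 := hmax b (mem_range.2 (by omega))
    have h2 : B b ≠ B q := fun h => hmin b hbr ⟨by omega, h⟩
    have h3 := lt_of_le_of_ne h1 h2
    rw [hb, Nat.add_comm p b, hB]
    linarith

lemma exists_rotation (c : Fin n → ℝ) (σ : Perm (Fin n)) (j : Fin n) :
    ∃ r, ∀ a, a < (j : ℕ) + 1 → psum c (σ * j.cycleRange ^ r) a ≤ 0 ∨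
      psum c (σ * j.cycleRange ^ r) a < psum c σ (j + 1) := by
  obtain ⟨r, hr⟩ := exists_shift_le_zero_or_lt (Nat.succ_pos j) (cycSum_add_period c σ j)
  refine ⟨r, fun a ha => ?_⟩
  rw [psum_mul_cycleRange_pow c σ j r ha.le]
  exact hr a ha

/-! ### Counting -/

lemma card_le_mul_card_of_rotation (j : Fin n) (X Y : Finset (Perm (Fin n)))
    (h : ∀ σ ∈ X, ∃ r, σ * j.cycleRange ^ r ∈ Y) : #X ≤ (j + 1) * #Y := by
  have hsub : X ⊆ (range ((j : ℕ) + 1)).biUnion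
      fun r => Y.image fun σ => σ * (j.cycleRange ^ r)⁻¹ := by
    intro σ hσ
    obtain ⟨r, hr⟩ := h σ hσ
    rw [pow_eq_pow_mod r (cycleRange_pow_succ_eq_one j)] at hr
    simp only [mem_biUnion, mem_image, mem_range]
    exact ⟨r % (j + 1), Nat.mod_lt _ (Nat.succ_pos _), _, hr, by group⟩
  calc #X ≤ _ := card_le_card hsub
    _ ≤ _ := card_biUnion_le_card_mul _ _ #Y fun r _ => card_image_le
    _ = _ := by simp

lemma mul_card_le_card_of_rotation (j : Fin n) (X Y : Finset (Perm (Fin n)))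
    (h : ∀ σ r, σ * j.cycleRange ^ r ∈ Y → σ ∈ X)
    (h' : ∀ σ, ∀ r < (j : ℕ) + 1, ∀ s < (j : ℕ) + 1,
      σ * j.cycleRange ^ r ∈ Y → σ * j.cycleRange ^ s ∈ Y → r = s) :
    (j + 1) * #Y ≤ #X := by
  have hdisj : ((range ((j : ℕ) + 1) : Finset ℕ) : Set ℕ).PairwiseDisjoint
      fun r => Y.image fun σ => σ * (j.cycleRange ^ r)⁻¹ := by
    intro r hr s hs hrs
    rw [Function.onFun, disjoint_left]
    intro σ h1 h2
    simp only [mem_image] at h1 h2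
    obtain ⟨σ₁, h1, rfl⟩ := h1
    obtain ⟨σ₂, h2, h3⟩ := h2
    refine hrs (h' (σ₁ * (j.cycleRange ^ r)⁻¹) r (by simpa using hr) s (by simpa using hs) ?_ ?_)
    · simpa using h1
    · rw [← h3]
      simpa using h2
  have hsub : (range ((j : ℕ) + 1)).biUnion
      (fun r => Y.image fun σ => σ * (j.cycleRange ^ r)⁻¹) ⊆ X := by
    intro σ hσ
    simp only [mem_biUnion, mem_image, mem_range] at hσ
    obtain ⟨r, -, σ₁, h1, rfl⟩ := hσ
    exact h _ r (by simpa using h1)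
  have := card_le_card hsub
  rw [card_biUnion hdisj] at this
  simp only [card_image_of_injective _ (mul_left_injective _)] at this
  simpa using this

lemma card_filter_initial_eq (S : Finset (Fin n)) :
    #{σ : Perm (Fin n) | initial σ #S = S} = (#S).factorial * (n - #S).factorial := by
  have h := Numbering.card_prefixed S
  rw [Fintype.card_fin] at h
  rw [← h]
  refine card_bij (fun σ _ => σ.symm.trans (finCongr (Fintype.card_fin n).symm)) ?_ ?_ ?_
  · intro σ hσ
    rw [Numbering.mem_prefixed]
    intro x
    have : initial σ #S = S := by simpa using hσ
    conv_lhs => rw [← this]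
    simp [mem_initial]
  · intro σ _ τ _ h
    have := congrArg (fun f => (f.trans (finCongr (Fintype.card_fin n))).symm) h
    ext x
    simpa using congrArg Fin.val (Equiv.congr_fun this x)
  · intro f hf
    rw [Numbering.mem_prefixed] at hf
    refine ⟨(f.trans (finCongr (Fintype.card_fin n))).symm, ?_, ?_⟩
    · simp only [mem_filter, mem_univ, true_and]
      ext x
      rw [mem_initial, hf x]
      simp
    · ext x
      simp

lemma factorial_div_le_card_filter_initial {S : Finset (Fin n)} (hS : S.Nonempty) :
    (n.factorial : ℝ) * (1 / ((n : ℝ) * ((n - 1).choose (n / 2)))) ≤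
      (#{σ : Perm (Fin n) | initial σ #S = S} : ℝ) / #S := by
  rw [card_filter_initial_eq]
  have hle : #S ≤ n := by simpa using card_le_univ S
  obtain ⟨t, ht⟩ : ∃ t, #S = t + 1 := Nat.exists_eq_succ_of_ne_zero hS.card_pos.ne'
  obtain ⟨m, rfl⟩ : ∃ m, n = m + 1 := ⟨n - 1, by omega⟩
  rw [ht, Nat.add_sub_cancel, Nat.add_sub_add_right]
  have htm : t ≤ m := by omega
  have hmid : m.choose t ≤ m.choose ((m + 1) / 2) := by
    refine (Nat.choose_le_middle t m).trans_eq (Nat.choose_symm_of_eq_add ?_)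
    omega
  have hpos : 0 < m.choose ((m + 1) / 2) := Nat.choose_pos (by omega)
  have hfac := Nat.choose_mul_factorial_mul_factorial htm
  have hkey : m.factorial ≤ t.factorial * (m - t).factorial * m.choose ((m + 1) / 2) := by
    rw [← hfac, mul_assoc, mul_comm]
    exact Nat.mul_le_mul_left _ hmid
  have hkey' : (m.factorial : ℝ) ≤
      t.factorial * (m - t).factorial * m.choose ((m + 1) / 2) := by exact_mod_cast hkey
  have hpos' : (0 : ℝ) < m.choose ((m + 1) / 2) := by exact_mod_cast hpos
  rw [Nat.factorial_succ, Nat.factorial_succ]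
  push_cast
  have e1 : ((m : ℝ) + 1) * m.factorial * (1 / (((m : ℝ) + 1) * m.choose ((m + 1) / 2))) =
      m.factorial / m.choose ((m + 1) / 2) := by
    field_simp
  have e2 : ((t : ℝ) + 1) * t.factorial * (m - t).factorial / (t + 1) =
      t.factorial * (m - t).factorial := by
    field_simp
  rw [e1, e2, div_le_iff₀ hpos']
  exact hkey'

/-! ### The weight of a hyperplane -/

open scoped Classical in
/-- The orderings whose first `j + 1` coordinates form a point of the hyperplane `c`. -/
noncomputable def hits (c : Fin n → ℝ) (j : Fin n) : Finset (Perm (Fin n)) :=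
  {σ | psum c σ (j + 1) = 1}

open scoped Classical in
/-- The orderings whose partial sums equal `1` at `j + 1` and are smaller than `1` before. -/
noncomputable def firstHits (c : Fin n → ℝ) (j : Fin n) : Finset (Perm (Fin n)) :=
  {σ | psum c σ (j + 1) = 1 ∧ ∀ a < (j : ℕ) + 1, psum c σ a < 1}

/-- The weight of the hyperplane `c`, where a point with `i` nonzero coordinates has weight
proportional to `1 / (i * n.choose i)`. -/
noncomputable def weight (c : Fin n → ℝ) : ℝ := ∑ j : Fin n, (#(hits c j) : ℝ) / ((j : ℕ) + 1)

lemma mem_hits {c : Fin n → ℝ} {j : Fin n} {σ : Perm (Fin n)} :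
    σ ∈ hits c j ↔ psum c σ (j + 1) = 1 := by simp [hits]

lemma mem_firstHits {c : Fin n → ℝ} {j : Fin n} {σ : Perm (Fin n)} :
    σ ∈ firstHits c j ↔ psum c σ (j + 1) = 1 ∧ ∀ a < (j : ℕ) + 1, psum c σ a < 1 := by
  simp [firstHits]

lemma pairwiseDisjoint_firstHits (c : Fin n → ℝ) :
    ((univ : Finset (Fin n)) : Set (Fin n)).PairwiseDisjoint (firstHits c) := by
  have key : ∀ i j : Fin n, i < j → Disjoint (firstHits c i) (firstHits c j) := by
    intro i j hij
    rw [disjoint_left]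
    intro σ hi hj
    rw [mem_firstHits] at hi hj
    have h' : (i : ℕ) < j := hij
    have := hj.2 (i + 1) (by omega)
    linarith [hi.1]
  intro i _ j _ hij
  rcases lt_or_gt_of_ne hij with h | h
  · exact key i j h
  · exact (key j i h).symm

lemma exists_rotation_firstHits {c : Fin n → ℝ} {j : Fin n} {σ : Perm (Fin n)}
    (hσ : σ ∈ hits c j) : ∃ r, σ * j.cycleRange ^ r ∈ firstHits c j := by
  rw [mem_hits] at hσ
  obtain ⟨r, hr⟩ := exists_rotation c σ j
  refine ⟨r, mem_firstHits.2 ⟨by rw [psum_mul_cycleRange_pow_succ, hσ], fun a ha => ?_⟩⟩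
  rcases hr a ha with h | h <;> linarith

lemma card_add_weight_le {c : Fin n → ℝ} {E : Finset (Perm (Fin n))}
    (hE : ∀ j, ∀ σ ∈ hits c j, ∃ r, σ * j.cycleRange ^ r ∈ firstHits c j \ E) :
    #E + weight c ≤ n.factorial := by
  have h1 : weight c ≤ ∑ j, (#(firstHits c j \ E) : ℝ) := by
    refine sum_le_sum fun j _ => ?_
    rw [div_le_iff₀ (by positivity), mul_comm]
    exact_mod_cast card_le_mul_card_of_rotation j _ _ (hE j)
  have h2 : #E + ∑ j, #(firstHits c j \ E) ≤ n.factorial := by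
    rw [← card_biUnion fun i hi j hj hij =>
        (pairwiseDisjoint_firstHits c hi hj hij).mono sdiff_subset sdiff_subset,
      ← card_union_of_disjoint]
    · refine (card_le_univ _).trans_eq ?_
      rw [Fintype.card_perm, Fintype.card_fin]
    · rw [disjoint_biUnion_right]
      exact fun j _ => disjoint_sdiff
  have h3 : (#E : ℝ) + ∑ j, (#(firstHits c j \ E) : ℝ) ≤ n.factorial := by exact_mod_cast h2
  linarith

lemma weight_le (c : Fin n → ℝ) : weight c ≤ n.factorial := by
  have := card_add_weight_le (c := c) (E := ∅) fun j σ hσ => by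
    simpa using exists_rotation_firstHits hσ
  simpa using this

/-- The weight of the point with support `T` can be added to the weight of `c`. -/
def Extends (c : Fin n → ℝ) (T : Finset (Fin n)) : Prop :=
  (#{σ : Perm (Fin n) | initial σ #T = T} : ℝ) / #T + weight c ≤ n.factorial

lemma extends_of_rotation {c : Fin n → ℝ} {T : Finset (Fin n)} {i : Fin n} (hT : #T = i + 1)
    {E : Finset (Perm (Fin n))}
    (hTE : ∀ σ, initial σ (i + 1) = T → ∃ r, σ * i.cycleRange ^ r ∈ E)
    (hE : ∀ j, ∀ σ ∈ hits c j, ∃ r, σ * j.cycleRange ^ r ∈ firstHits c j \ E) :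
    Extends c T := by
  have h1 := card_add_weight_le hE
  have h2 := card_le_mul_card_of_rotation i {σ | initial σ #T = T} E fun σ hσ =>
    hTE σ (by simpa [hT] using hσ)
  have h3 : (#{σ : Perm (Fin n) | initial σ #T = T} : ℝ) / #T ≤ #E := by
    rw [div_le_iff₀ (by rw [hT]; positivity), mul_comm]
    rw [hT] at h2 ⊢
    exact_mod_cast h2
  rw [Extends]
  linarith

lemma extends_univ {c : Fin n → ℝ} (hn : 0 < n) (hc : ∑ e, c e < 1) : Extends c univ := by
  classical
  obtain ⟨m, rfl⟩ : ∃ m, n = m + 1 := ⟨n - 1, by omega⟩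
  refine extends_of_rotation (i := Fin.last m) (by simp)
    (E := {σ | ∀ a ≤ m + 1, psum c σ a < 1}) ?_ ?_
  · intro σ _
    obtain ⟨r, hr⟩ := exists_rotation c σ (Fin.last m)
    refine ⟨r, ?_⟩
    simp only [mem_filter, mem_univ, true_and]
    intro a ha
    rcases ha.lt_or_eq with h | rfl
    · have hs : psum c σ ((Fin.last m : ℕ) + 1) = ∑ e, c e := by
        rw [← psum_card c σ, Fin.val_last]
      rcases hr a (by simpa using h) with h | h <;> linarith
    · rwa [psum_card]
  · intro j σ hσ
    obtain ⟨r, hr⟩ := exists_rotation_firstHits hσ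
    refine ⟨r, mem_sdiff.2 ⟨hr, fun h => ?_⟩⟩
    simp only [mem_filter, mem_univ, true_and] at h
    have := h (j + 1) (by have := j.2; omega)
    linarith [(mem_firstHits.1 hr).1]

lemma extends_singleton {c : Fin n → ℝ} {e : Fin n} (he : 1 < c e) : Extends c {e} := by
  classical
  have hn : 0 < n := e.pos
  have hsum : ∀ σ : Perm (Fin n), initial σ 1 = {e} → psum c σ 1 = c e := fun σ hσ => by
    rw [psum_eq_sum_initial c σ hn, hσ, sum_singleton]
  refine extends_of_rotation (i := ⟨0, hn⟩) (by simp) (E := {σ | initial σ 1 = {e}}) ?_ ?_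
  · intro σ hσ
    exact ⟨0, by simpa using hσ⟩
  · intro j σ hσ
    obtain ⟨r, hr⟩ := exists_rotation_firstHits hσ
    refine ⟨r, mem_sdiff.2 ⟨hr, fun h => ?_⟩⟩
    have h1 := hsum _ (by simpa using h)
    rw [mem_firstHits] at hr
    rcases Nat.eq_zero_or_pos (j : ℕ) with h0 | h0
    · rw [h0] at hr
      linarith [hr.1]
    · linarith [hr.2 1 (by omega)]

lemma extends_of_sum_mem_Ioo {c : Fin n → ℝ} {T : Finset (Fin n)} (h0 : 0 < ∑ e ∈ T, c e)
    (h1 : ∑ e ∈ T, c e < 1) : Extends c T := by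
  classical
  have hTne : T.Nonempty := nonempty_iff_ne_empty.2 fun h => by simp [h] at h0
  have hTn : #T ≤ n := by simpa using card_le_univ T
  have hTpos := hTne.card_pos
  set v := ∑ e ∈ T, c e with hv
  have hi : #T - 1 < n := by omega
  have hi' : #T - 1 + 1 = #T := by omega
  have hsum : ∀ σ : Perm (Fin n), initial σ #T = T → psum c σ #T = v := fun σ hσ => by
    rw [psum_eq_sum_initial c σ hTn, hσ]
  refine extends_of_rotation (i := ⟨#T - 1, hi⟩) hi'.symm
    (E := {σ | initial σ #T = T ∧ ∀ a < #T, psum c σ a < v}) ?_ ?_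
  · intro σ hσ
    obtain ⟨r, hr⟩ := exists_rotation c σ ⟨#T - 1, hi⟩
    have hinit := initial_mul_cycleRange_pow σ ⟨#T - 1, hi⟩ r
    simp only [hi'] at hr hσ hinit
    refine ⟨r, ?_⟩
    simp only [mem_filter, mem_univ, true_and]
    refine ⟨hinit.trans hσ, fun a ha => ?_⟩
    have := hsum σ hσ
    rcases hr a ha with h | h <;> linarith
  · intro j σ hσ
    obtain ⟨r, hr⟩ := exists_rotation_firstHits hσ
    by_cases hmem : σ * j.cycleRange ^ r ∈
        ({σ | initial σ #T = T ∧ ∀ a < #T, psum c σ a < v} : Finset (Perm (Fin n)))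
    swap
    · exact ⟨r, mem_sdiff.2 ⟨hr, hmem⟩⟩
    refine ⟨r + #T, ?_⟩
    rw [pow_add, ← mul_assoc]
    generalize σ * j.cycleRange ^ r = τ at hr hmem
    simp only [mem_filter, mem_univ, true_and] at hmem
    obtain ⟨hτT, hτ⟩ := hmem
    rw [mem_firstHits] at hr
    have hτv := hsum τ hτT
    have hjT : #T < (j : ℕ) + 1 := by
      by_contra! hle
      rcases hle.lt_or_eq with h | h
      · linarith [hτ _ h, hr.1]
      · rw [← h, hr.1] at hτv
        linarith
    have hjn := j.2
    refine mem_sdiff.2 ⟨mem_firstHits.2 ⟨?_, fun a ha => ?_⟩, fun h => ?_⟩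
    · rw [psum_mul_cycleRange_pow_succ, hr.1]
    · rw [psum_mul_cycleRange_pow c τ j _ ha.le, cycSum_of_le c τ j hjT.le, hτv]
      rcases lt_or_ge (#T + a) ((j : ℕ) + 1) with h | h
      · rw [cycSum_of_le c τ j h.le]
        linarith [hr.2 _ h]
      · obtain ⟨b, hb⟩ := Nat.exists_eq_add_of_le h
        have hb' : b < #T := by omega
        rw [hb, Nat.add_comm _ b, cycSum_add_period, hr.1, cycSum_of_le c τ j (by omega)]
        linarith [hτ b hb']
    · simp only [mem_filter, mem_univ, true_and] at h
      have hz : (τ * j.cycleRange ^ #T) ⟨0, by omega⟩ ∈ initial (τ * j.cycleRange ^ #T) #T := by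
        rw [mem_initial, symm_apply_apply]
        exact hTpos
      replace hz := (Finset.ext_iff.1 (h.1.trans hτT.symm) _).1 hz
      rw [mem_initial, Perm.mul_apply, symm_apply_apply,
        cycleRange_pow_val_of_le j _ (by rw [Fin.le_def]; simp), Nat.zero_add,
        Nat.mod_eq_of_lt hjT] at hz
      exact lt_irrefl _ hz

lemma exists_psum_eq_intCast {c : Fin n → ℝ} (hc : ∀ e, ∃ z : ℤ, c e = z) (σ : Perm (Fin n))
    (i : ℕ) : ∃ z : ℤ, psum c σ i = z := by
  induction i with
  | zero => exact ⟨0, by simp [psum_zero]⟩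
  | succ i ih =>
    obtain ⟨z, hz⟩ := ih
    by_cases h : i < n
    · obtain ⟨w, hw⟩ := hc (σ ⟨i, h⟩)
      exact ⟨z + w, by rw [psum_succ, hz, seq, dif_pos h, hw]; push_cast; rfl⟩
    · exact ⟨z, by rw [psum_succ, hz, seq, dif_neg h, add_zero]⟩

lemma factorial_le_weight {c : Fin n → ℝ} (hc : ∀ e, ∃ z : ℤ, c e = z) (hle : ∀ e, c e ≤ 1)
    (hsum : 1 ≤ ∑ e, c e) : n.factorial ≤ weight c := by
  classical
  have hint : ∀ (σ : Perm (Fin n)) (i : ℕ), psum c σ i < 1 → psum c σ i ≤ 0 := fun σ i h => by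
    obtain ⟨z, hz⟩ := exists_psum_eq_intCast hc σ i
    rw [hz] at h ⊢
    have : z < 1 := by exact_mod_cast h
    exact_mod_cast (by omega : z ≤ 0)
  have h1 : ∑ j, (#(firstHits c j) : ℝ) ≤ weight c := by
    refine sum_le_sum fun j _ => ?_
    rw [le_div_iff₀ (by positivity), mul_comm]
    have := mul_card_le_card_of_rotation j (hits c j) (firstHits c j) (fun σ r h => by
      rw [mem_firstHits, psum_mul_cycleRange_pow_succ] at h
      exact mem_hits.2 h.1) ?_
    · exact_mod_cast this
    have key : ∀ (σ : Perm (Fin n)) (r s : ℕ), r < s → s < (j : ℕ) + 1 →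
        σ * j.cycleRange ^ r ∈ firstHits c j → σ * j.cycleRange ^ s ∈ firstHits c j → False := by
      intro σ r s hrs hs h1 h2
      rw [mem_firstHits] at h1 h2
      have h3 := hint _ _ (h1.2 (s - r) (by omega))
      have h4 := hint _ _ (h2.2 (r + (j + 1) - s) (by omega))
      rw [psum_mul_cycleRange_pow c σ j _ (by omega)] at h3 h4
      rw [show r + (s - r) = s by omega] at h3
      rw [show s + (r + ((j : ℕ) + 1) - s) = r + (j + 1) by omega, cycSum_add_period] at h4
      rw [psum_mul_cycleRange_pow_succ] at h1
      linarith [h1.1]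
    intro σ r hr s hs h1 h2
    rcases lt_trichotomy r s with h | h | h
    · exact (key σ r s h hs h1 h2).elim
    · exact h
    · exact (key σ s r h hr h2 h1).elim
  have h2 : n.factorial ≤ ∑ j, #(firstHits c j) := by
    have hcard : #(univ : Finset (Perm (Fin n))) = n.factorial := by
      rw [card_univ, Fintype.card_perm, Fintype.card_fin]
    rw [← hcard]
    refine (card_le_card fun σ _ => ?_).trans card_biUnion_le
    have hex : ∃ i, 1 ≤ psum c σ i := ⟨n, by rwa [psum_card]⟩
    have hfind := Nat.find_spec hex
    have hmin := fun m (hm : m < Nat.find hex) => not_le.1 (Nat.find_min hex hm)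
    have hfn : Nat.find hex ≤ n := Nat.find_min' hex (by rwa [psum_card])
    generalize Nat.find hex = i at *
    cases i with
    | zero => rw [psum_zero] at hfind; linarith
    | succ i =>
      refine mem_biUnion.2 ⟨⟨i, hfn⟩, mem_univ _, mem_firstHits.2 ⟨le_antisymm ?_ hfind, hmin⟩⟩
      have h3 := hint σ i (hmin i (by omega))
      have h4 : seq c σ i ≤ 1 := by
        rw [seq, dif_pos (Nat.lt_of_succ_le hfn)]
        exact hle _
      rw [psum_succ]
      linarith
  have h3 : (n.factorial : ℝ) ≤ ∑ j, (#(firstHits c j) : ℝ) := by exact_mod_cast h2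
  exact h3.trans h1

lemma weight_eq_or_exists_extends (hn : 0 < n) (c : Fin n → ℝ) :
    weight c = n.factorial ∨ ∃ T : Finset (Fin n), T.Nonempty ∧ Extends c T := by
  classical
  by_contra! hcon
  obtain ⟨hne, hT⟩ := hcon
  have : Nonempty (Fin n) := ⟨⟨0, hn⟩⟩
  have hsum : 1 ≤ ∑ e, c e := by
    by_contra! h
    exact hT _ univ_nonempty (extends_univ hn h)
  have hle : ∀ e, c e ≤ 1 := fun e => by
    by_contra! h
    exact hT _ (singleton_nonempty e) (extends_singleton h)
  have hgap : ∀ S : Finset (Fin n), 0 < ∑ e ∈ S, c e → 1 ≤ ∑ e ∈ S, c e := fun S h => by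
    by_contra! h'
    refine hT S (nonempty_iff_ne_empty.2 fun hS => ?_) (extends_of_sum_mem_Ioo h h')
    simp [hS] at h
  have hval : ∀ e, 0 < c e → c e = 1 := fun e he =>
    le_antisymm (hle e) (by simpa using hgap {e} (by simpa using he))
  refine hne (le_antisymm (weight_le c) (factorial_le_weight (fun e => ?_) hle hsum))
  by_contra! hz
  have hneg : c e < 0 := by
    rcases lt_trichotomy (c e) 0 with h | h | h
    · exact h
    · exact (hz 0 (by simpa using h)).elim
    · exact (hz 1 (by simpa using hval e h)).elim
  set A : Finset (Fin n) := {x | 0 < c x} with hA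
  have heA : e ∉ A := by simp [hA, hneg.le]
  have hAsum : ∀ B ⊆ A, ∑ x ∈ B, c x = #B := fun B hB => by
    rw [sum_congr rfl fun x hx => hval x (by simpa [hA] using hB hx)]
    simp
  have hbound : ∑ x, c x ≤ c e + #A := by
    rw [← hAsum A subset_rfl, ← sum_insert heA]
    have hrest : ∑ x ∈ (insert e A)ᶜ, c x ≤ 0 := sum_nonpos fun x hx => by
      have : x ∉ A := fun h' => mem_compl.1 hx (mem_insert_of_mem h')
      simpa [hA] using this
    linarith [sum_add_sum_compl (insert e A) c]
  have hceil : ⌈-c e⌉₊ ≤ #A := Nat.ceil_le.2 (by linarith)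
  obtain ⟨B, hB, hBcard⟩ := exists_subset_card_eq hceil
  have heB : e ∉ B := fun h => heA (hB h)
  have hBsum : ∑ x ∈ insert e B, c x = c e + ⌈-c e⌉₊ := by
    rw [sum_insert heB, hAsum B hB, hBcard]
  have h1 := Nat.le_ceil (-c e)
  have h2 := Nat.ceil_lt_add_one (a := -c e) (by linarith)
  have h3 : -c e ≠ ⌈-c e⌉₊ := fun h => hz (-(⌈-c e⌉₊ : ℕ)) (by push_cast; linarith)
  have h4 := lt_of_le_of_ne h1 h3
  have h5 := hgap (insert e B) (by rw [hBsum]; linarith)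
  rw [hBsum] at h5
  linarith

/-! ### Covers -/

open scoped Classical in
/-- The number of hyperplanes of the family `d` through the point with support `S`. -/
noncomputable def covers {m : ℕ} (d : Fin m → Fin n → ℝ) (S : Finset (Fin n)) : ℕ :=
  #{l | ∑ e ∈ S, d l e = 1}

lemma sum_weight_eq {m : ℕ} (d : Fin m → Fin n → ℝ) :
    ∑ l, weight (d l) =
      ∑ j : Fin n, (∑ σ : Perm (Fin n), (covers d (initial σ (j + 1)) : ℝ)) / ((j : ℕ) + 1) := by
  classical
  simp only [weight]
  rw [sum_comm]
  refine sum_congr rfl fun j _ => ?_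
  rw [← sum_div]
  congr 1
  simp only [covers, hits, card_filter, psum_eq_sum_initial _ _ (Nat.succ_le_of_lt j.2)]
  push_cast
  rw [sum_comm]

lemma harmonicR_eq_sum : harmonicR n = ∑ j : Fin n, 1 / (((j : ℕ) : ℝ) + 1) := by
  rw [harmonicR, Finset.sum_range]

lemma nonempty_initial (σ : Perm (Fin n)) (j : Fin n) : (initial σ (j + 1)).Nonempty := by
  rw [← card_pos, card_initial σ (Nat.succ_le_of_lt j.2)]
  exact Nat.succ_pos _

lemma sum_weight_sub {m k : ℕ} (d : Fin m → Fin n → ℝ) :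
    ∑ l, weight (d l) - k * harmonicR n * n.factorial =
      ∑ j : Fin n,
        (∑ σ : Perm (Fin n), ((covers d (initial σ (j + 1)) : ℝ) - k)) / ((j : ℕ) + 1) := by
  rw [sum_weight_eq, harmonicR_eq_sum, mul_sum, sum_mul, ← sum_sub_distrib]
  refine sum_congr rfl fun j _ => ?_
  rw [sum_sub_distrib, sum_const, card_univ, Fintype.card_perm, Fintype.card_fin, nsmul_eq_mul]
  ring

lemma le_sum_weight {m k : ℕ} {d : Fin m → Fin n → ℝ}
    (hd : ∀ S : Finset (Fin n), S.Nonempty → k ≤ covers d S) :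
    k * harmonicR n * n.factorial ≤ ∑ l, weight (d l) := by
  rw [← sub_nonneg, sum_weight_sub]
  refine sum_nonneg fun j _ => div_nonneg (sum_nonneg fun σ _ => ?_) (by positivity)
  rw [sub_nonneg]
  exact_mod_cast hd _ (nonempty_initial σ j)

/-- If some point is covered more than `k` times, then there is excess weight. -/
lemma add_le_sum_weight {m k : ℕ} {d : Fin m → Fin n → ℝ}
    (hd : ∀ S : Finset (Fin n), S.Nonempty → k ≤ covers d S)
    {S : Finset (Fin n)} (hS : S.Nonempty) (hSk : k < covers d S) :
    k * harmonicR n * n.factorial +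
      n.factorial * (1 / ((n : ℝ) * ((n - 1).choose (n / 2)))) ≤ ∑ l, weight (d l) := by
  have h1 := factorial_div_le_card_filter_initial hS
  have hcard : #S ≤ n := by simpa using card_le_univ S
  have hpos := hS.card_pos
  have hnonneg : ∀ (j : Fin n) (σ : Perm (Fin n)),
      0 ≤ (covers d (initial σ (j + 1)) : ℝ) - k := fun j σ => by
    rw [sub_nonneg]
    exact_mod_cast hd _ (nonempty_initial σ j)
  have h2 : (#{σ : Perm (Fin n) | initial σ #S = S} : ℝ) / #S ≤
      ∑ l, weight (d l) - k * harmonicR n * n.factorial := by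
    rw [sum_weight_sub]
    refine le_trans ?_ (single_le_sum
      (fun j _ => div_nonneg (sum_nonneg fun σ _ => hnonneg j σ) (by positivity))
      (mem_univ (⟨#S - 1, by omega⟩ : Fin n)))
    have hi : #S - 1 + 1 = #S := by omega
    have hi' : ((#S - 1 : ℕ) : ℝ) + 1 = #S := by exact_mod_cast hi
    have hnonneg' := hnonneg ⟨#S - 1, by omega⟩
    simp only [hi, hi'] at hnonneg' ⊢
    gcongr
    rw [card_filter]
    push_cast
    refine sum_le_sum fun σ _ => ?_
    split_ifs with h
    · rw [h, le_sub_iff_add_le, add_comm]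
      exact_mod_cast hSk
    · exact hnonneg' σ
  linarith

lemma ceil_add_one_le_of_cover (hn : 0 < n) {m k : ℕ} {d : Fin m → Fin n → ℝ}
    (hd : ∀ S : Finset (Fin n), S.Nonempty → k ≤ covers d S)
    (h1 : 0 < (⌈(k : ℝ) * harmonicR n⌉ : ℝ) - (k : ℝ) * harmonicR n)
    (h2 : (⌈(k : ℝ) * harmonicR n⌉ : ℝ) - (k : ℝ) * harmonicR n <
      1 / ((n : ℝ) * ((n - 1).choose (n / 2)))) :
    ⌈(k : ℝ) * harmonicR n⌉ + 1 ≤ (m : ℤ) := by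
  have hfac : (0 : ℝ) < n.factorial := by exact_mod_cast n.factorial_pos
  have hlow := le_sum_weight hd
  by_contra! hlt
  set δ : ℝ := 1 / ((n : ℝ) * ((n - 1).choose (n / 2)))
  have hm : (m : ℝ) ≤ ⌈(k : ℝ) * harmonicR n⌉ := by exact_mod_cast Int.lt_add_one_iff.1 hlt
  have hsmall : (m : ℝ) * n.factorial < (k * harmonicR n + δ) * n.factorial := by
    gcongr
    linarith
  by_cases hall : ∀ l, weight (d l) = n.factorial
  · have hsum : ∑ l, weight (d l) = m * n.factorial := by simp [hall]
    rw [hsum] at hlow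
    have hmk := le_of_mul_le_mul_right hlow hfac
    have hmc : ⌈(k : ℝ) * harmonicR n⌉ ≤ (m : ℤ) := Int.ceil_le.2 (by exact_mod_cast hmk)
    have hmc' : (⌈(k : ℝ) * harmonicR n⌉ : ℝ) ≤ m := by exact_mod_cast hmc
    by_cases hex : ∃ S : Finset (Fin n), S.Nonempty ∧ k < covers d S
    · obtain ⟨S, hS, hSk⟩ := hex
      have := add_le_sum_weight hd hS hSk
      rw [hsum] at this
      linarith
    · push Not at hex
      have hzero := sum_weight_sub (k := k) d
      rw [hsum, sum_eq_zero] at hzero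
      · have : ((m : ℝ) - k * harmonicR n) * n.factorial = 0 := by linarith
        rcases mul_eq_zero.1 this with h | h <;> linarith
      · intro j _
        rw [sum_eq_zero, zero_div]
        intro σ _
        have hne := nonempty_initial σ j
        rw [le_antisymm (hex _ hne) (hd _ hne), sub_self]
  · push Not at hall
    obtain ⟨l, hl⟩ := hall
    obtain ⟨T, hT, hext⟩ := (weight_eq_or_exists_extends hn (d l)).resolve_left hl
    have hcount := factorial_div_le_card_filter_initial hT
    rw [Extends] at hext
    have hrest : ∑ x ∈ univ.erase l, weight (d x) ≤ (m - 1 : ℝ) * n.factorial := by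
      refine (sum_le_sum fun x _ => weight_le (d x)).trans_eq ?_
      rw [sum_const, card_erase_of_mem (mem_univ l), card_univ, Fintype.card_fin, nsmul_eq_mul,
        Nat.cast_sub l.pos, Nat.cast_one]
    rw [← add_sum_erase _ _ (mem_univ l)] at hlow
    linarith

open scoped Classical in
lemma exists_family_of_multiset {C : Multiset (Fin n → ℝ)} {k : ℕ}
    (hC : ∀ x : Fin n → ℝ, (∀ i, x i = 0 ∨ x i = 1) → x ≠ 0 →
      k ≤ Multiset.card (C.filter (fun c => ∑ i, c i * x i = 1))) :
    ∃ (m : ℕ) (d : Fin m → Fin n → ℝ), Multiset.card C = m ∧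
      ∀ S : Finset (Fin n), S.Nonempty → k ≤ covers d S := by
  induction C using Quotient.inductionOn with | h L
  refine ⟨L.length, L.get, rfl, fun S hS => ?_⟩
  obtain ⟨e, he⟩ := hS
  refine (hC (fun i => if i ∈ S then 1 else 0) (fun i => ?_) fun h => ?_).trans_eq ?_
  · by_cases hi : i ∈ S <;> simp [hi]
  · simpa [he] using congrFun h e
  · have hL : ((L : Multiset (Fin n → ℝ))) =
        (univ : Finset (Fin L.length)).val.map L.get := by
      simp
    change Multiset.card (Multiset.filter _ (L : Multiset (Fin n → ℝ))) = _
    rw [hL, Multiset.filter_map, Multiset.card_map]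
    simp only [covers, card_def, filter_val, Function.comp_def, mul_ite, mul_one, mul_zero,
      sum_ite_mem, univ_inter]

/-- Repeating each hyperplane `x i = 1` exactly `k` times gives an almost `k`-cover. -/
lemma exists_cover (n k : ℕ) : ∃ C : Multiset (Fin n → ℝ),
    ∀ x : Fin n → ℝ, (∀ i, x i = 0 ∨ x i = 1) → x ≠ 0 →
      k ≤ Multiset.card (C.filter (fun c => ∑ i, c i * x i = 1)) := by
  classical
  refine ⟨∑ e : Fin n, Multiset.replicate k (Pi.single e 1), fun x hx hx0 => ?_⟩
  obtain ⟨e, he⟩ := Function.ne_iff.1 hx0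
  have hxe : x e = 1 := (hx e).resolve_left he
  have hle : Multiset.replicate k (Pi.single e (1 : ℝ) : Fin n → ℝ) ≤
      ∑ e : Fin n, Multiset.replicate k (Pi.single e 1) :=
    single_le_sum (f := fun e : Fin n => Multiset.replicate k (Pi.single e (1 : ℝ) : Fin n → ℝ))
      (fun _ _ => Multiset.zero_le _) (mem_univ e)
  have hself : (Multiset.replicate k (Pi.single e (1 : ℝ))).filter
      (fun c : Fin n → ℝ => ∑ i, c i * x i = 1) = Multiset.replicate k (Pi.single e 1) := by
    rw [Multiset.filter_eq_self]
    intro c hc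
    rw [Multiset.eq_of_mem_replicate hc]
    simp [Pi.single_apply, hxe]
  have := Multiset.card_le_card (Multiset.filter_le_filter
    (fun c : Fin n → ℝ => ∑ i, c i * x i = 1) hle)
  rw [hself, Multiset.card_replicate] at this
  exact this

end AlmostCover

theorem lower_bound_plus_one (n k : ℕ) (hn : 1 ≤ n) (hk : 2 ≤ k)
    (h1 : 0 < (⌈(k : ℝ) * harmonicR n⌉ : ℝ) - (k : ℝ) * harmonicR n)
    (h2 : (⌈(k : ℝ) * harmonicR n⌉ : ℝ) - (k : ℝ) * harmonicR n <
      1 / ((n : ℝ) * ((n - 1).choose (n / 2)))) :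
    (⌈(k : ℝ) * harmonicR n⌉ + 1 : ℤ) ≤ (coverNumber n k : ℤ) := by
  classical
  obtain ⟨C₀, hC₀⟩ := AlmostCover.exists_cover n k
  obtain ⟨C, hcard, hC⟩ := Nat.sInf_mem (s := {m | ∃ C : Multiset (Fin n → ℝ),
    Multiset.card C = m ∧
    ∀ x : Fin n → ℝ, (∀ i, x i = 0 ∨ x i = 1) → x ≠ 0 →
      k ≤ Multiset.card (C.filter (fun c => ∑ i, c i * x i = 1))}) ⟨_, C₀, rfl, hC₀⟩
  obtain ⟨m, d, hm, hd⟩ := AlmostCover.exists_family_of_multiset hC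
  have := AlmostCover.ceil_add_one_le_of_cover hn hd h1 h2
  rw [← hm, hcard] at this
  exact this
end
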